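/- There exist a Lipschitz function f : [0,1] → [0,1] with ∫ f dν > 0 and positive constants c1, c2, κ1, κ2 such that, for every integer n > 2/∫ f dν, c1 e^{−κ1 n^γ} ≤ ν({x ∈ [0,1] : |S_n(f)(x)| > n (∫ f dν)/2}) ≤ c2 e^{−κ2 n^γ}, where S_n(f)(x) = Σ_{k=0}^{n−1} f(T^k(x)) − n ∫ f dν. -/

import Mathlib

open MeasureTheory Set

/-- The interval map `T` of the example: `T(x) = x (1 + c / |log x|^β)` on `(0, 1/2]`
with `β = 1/γ - 1`, `c = (log 2)^β`, `T(x) = 2x - 1` on `(1/2, 1]`, and `T(0) = 0`. -/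
noncomputable def Tmap (γ : ℝ) (x : ℝ) : ℝ :=
  if x ≤ 0 then 0
  else if x ≤ 1 / 2 then x * (1 + (Real.log 2) ^ (1 / γ - 1) / |Real.log x| ^ (1 / γ - 1))
  else 2 * x - 1


open Filter Topology

noncomputable def vv (γ x : ℝ) : ℝ := (Real.log 2) ^ (1 / γ - 1) / |Real.log x| ^ (1 / γ - 1)

noncomputable def LL (γ x : ℝ) : ℝ := x * (1 + vv γ x)

lemma beta_nonneg {γ : ℝ} (h0 : 0 < γ) (h1 : γ ≤ 1) : 0 ≤ 1 / γ - 1 := by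
  have : 1 ≤ 1 / γ := by rw [le_div_iff₀ h0]; linarith
  linarith

lemma abslog_ge {x : ℝ} (hx : 0 < x) (hx2 : x ≤ 1 / 2) : Real.log 2 ≤ |Real.log x| := by
  have h : Real.log x ≤ Real.log (1 / 2) := Real.log_le_log hx hx2
  have h2 : Real.log (1 / 2) = - Real.log 2 := by rw [one_div, Real.log_inv]
  have := Real.log_pos (by norm_num : (1 : ℝ) < 2)
  rw [abs_of_nonpos (by linarith)]
  linarith

lemma log2_pos : 0 < Real.log 2 := Real.log_pos (by norm_num)

lemma vv_pos (γ : ℝ) {x : ℝ} (hx : 0 < x) (hx2 : x ≤ 1 / 2) : 0 < vv γ x := by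
  have h1 := log2_pos
  have h2 := abslog_ge hx hx2
  unfold vv
  have : 0 < |Real.log x| := by linarith
  positivity

lemma vv_mono {γ : ℝ} (h0 : 0 < γ) (h1 : γ ≤ 1) {x y : ℝ} (hx : 0 < x) (hxy : x ≤ y)
    (hy : y ≤ 1 / 2) : vv γ x ≤ vv γ y := by
  have hb := beta_nonneg h0 h1
  have hl := log2_pos
  have h2 := abslog_ge (hx.trans_le hxy) hy
  have h3 := abslog_ge hx (hxy.trans hy)
  unfold vv
  have hlog : Real.log x ≤ Real.log y := Real.log_le_log hx hxy
  have h4 : |Real.log y| ≤ |Real.log x| := by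
    have hyy : Real.log y ≤ 0 := Real.log_nonpos (by linarith) (by linarith)
    rw [abs_of_nonpos hyy, abs_of_nonpos (by linarith)]; linarith
  have : 0 < |Real.log y| := by linarith
  gcongr

lemma vv_half (γ : ℝ) : vv γ (1 / 2) = 1 := by
  have hl := log2_pos
  unfold vv
  rw [one_div 2, Real.log_inv, abs_neg, abs_of_pos hl, div_self]
  positivity

lemma vv_le_one {γ : ℝ} (h0 : 0 < γ) (h1 : γ ≤ 1) {x : ℝ} (hx : 0 < x) (hx2 : x ≤ 1 / 2) :
    vv γ x ≤ 1 := by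
  rw [← vv_half γ]; exact vv_mono h0 h1 hx hx2 le_rfl

lemma vv_key {γ : ℝ} (h0 : 0 < γ) (h1 : γ ≤ 1) :
    ∃ K : ℝ, 1 ≤ K ∧ ∀ x : ℝ, 0 < x → x ≤ 1 / 2 → x ^ (1 / 8 : ℝ) ≤ K * vv γ x := by
  have hb := beta_nonneg h0 h1
  set β := 1 / γ - 1 with hβ
  have hl := log2_pos
  set t : ℝ := 1 / (8 * (β + 1)) with ht
  have htp : 0 < t := by positivity
  have hcp : 0 < (Real.log 2) ^ β := by positivity
  refine ⟨max 1 ((1 / t) ^ β / (Real.log 2) ^ β), le_max_left _ _, fun x hx hx2 => ?_⟩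
  have h2 := abslog_ge hx hx2
  have hup : 0 < |Real.log x| := by linarith
  have h3 := (Real.abs_log_mul_self_rpow_lt x t hx (by linarith) htp).le
  have hxt : 0 < x ^ t := by positivity
  rw [abs_mul, abs_of_pos hxt] at h3
  have h4 : (|Real.log x| * x ^ t) ^ β ≤ (1 / t) ^ β :=
    Real.rpow_le_rpow (by positivity) h3 hb
  rw [Real.mul_rpow hup.le hxt.le, ← Real.rpow_mul hx.le] at h4
  have h5 : x ^ (1 / 8 : ℝ) ≤ x ^ (t * β) := by
    apply Real.rpow_le_rpow_of_exponent_ge hx (by linarith)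
    rw [ht, div_mul_eq_mul_div, one_mul, div_le_div_iff₀ (by positivity) (by norm_num)]
    linarith
  have h6 : x ^ (1 / 8 : ℝ) ≤ (1 / t) ^ β / (Real.log 2) ^ β * vv γ x := by
    unfold vv
    rw [← hβ, div_mul_div_comm, mul_comm ((1 / t) ^ β), mul_div_mul_left _ _ hcp.ne',
      le_div_iff₀ (by positivity)]
    have : 0 < |Real.log x| ^ β := by positivity
    nlinarith
  refine h6.trans ?_
  have := vv_pos γ hx hx2
  gcongr
  exact le_max_right _ _

lemma Tmap_eq_LL (γ : ℝ) {x : ℝ} (hx : 0 ≤ x) (hx2 : x ≤ 1 / 2) : Tmap γ x = LL γ x := by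
  unfold Tmap LL vv
  rcases hx.eq_or_lt with h | h
  · simp [← h]
  · rw [if_neg (by linarith), if_pos hx2]

lemma LL_zero (γ : ℝ) : LL γ 0 = 0 := by simp [LL]

lemma LL_half (γ : ℝ) : LL γ (1 / 2) = 1 := by rw [LL, vv_half]; norm_num

lemma LL_strictMono {γ : ℝ} (h0 : 0 < γ) (h1 : γ ≤ 1) : StrictMonoOn (LL γ) (Icc 0 (1 / 2)) := by
  intro x hx y hy hxy
  have hvy := vv_pos γ (hx.1.trans_lt hxy) hy.2
  unfold LL
  rcases hx.1.eq_or_lt with h | h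
  · rw [← h]; simp only [zero_mul]
    have : 0 < y := hx.1.trans_lt hxy
    positivity
  · have := vv_mono h0 h1 h hxy.le hy.2
    have := vv_pos γ h hx.2
    nlinarith

lemma LL_le {γ : ℝ} (h0 : 0 < γ) (h1 : γ ≤ 1) {x : ℝ} (hx : 0 ≤ x) (hx2 : x ≤ 1 / 2) :
    x ≤ LL γ x ∧ LL γ x ≤ 2 * x := by
  rcases hx.eq_or_lt with h | h
  · rw [← h, LL_zero]; simp
  · have := vv_pos γ h hx2
    have := vv_le_one h0 h1 h hx2
    unfold LL
    constructor <;> nlinarith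

noncomputable def LD (γ x : ℝ) : ℝ := 1 + vv γ x + (1 / γ - 1) * vv γ x / |Real.log x|

lemma LL_hasDerivAt (γ : ℝ) {x : ℝ} (hx : 0 < x) (hx1 : x < 1) :
    HasDerivAt (LL γ) (LD γ x) x := by
  have hlog : Real.log x < 0 := Real.log_neg hx hx1
  set β := 1 / γ - 1 with hβ
  have hd : HasDerivAt (fun x : ℝ => x * (1 + (Real.log 2) ^ β * (-Real.log x) ^ (-β)))
      (1 * (1 + (Real.log 2) ^ β * (-Real.log x) ^ (-β)) +
        x * ((Real.log 2) ^ β * (-(x⁻¹) * (-β) * (-Real.log x) ^ (-β - 1)))) x := by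
    have e1 : HasDerivAt (fun x : ℝ => (-Real.log x) ^ (-β))
        (-(x⁻¹) * (-β) * (-Real.log x) ^ (-β - 1)) x :=
      HasDerivAt.rpow_const (Real.hasDerivAt_log hx.ne').neg (Or.inl (by linarith))
    exact (hasDerivAt_id x).mul ((e1.const_mul _).const_add 1)
  have heq : LL γ =ᶠ[𝓝 x] (fun x : ℝ => x * (1 + (Real.log 2) ^ β * (-Real.log x) ^ (-β))) := by
    filter_upwards [Ioo_mem_nhds hx hx1] with y hy
    have hly : Real.log y < 0 := Real.log_neg hy.1 hy.2
    unfold LL vv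
    rw [← hβ, abs_of_neg hly, Real.rpow_neg (by linarith), div_eq_mul_inv]
  refine (hd.congr_of_eventuallyEq heq).congr_deriv ?_
  unfold LD vv
  rw [← hβ]
  clear_value β
  have hne : -Real.log x ≠ 0 := by linarith
  rw [abs_of_neg hlog, Real.rpow_sub_one hne, Real.rpow_neg (by linarith)]
  have : 0 < (-Real.log x) ^ β := Real.rpow_pos_of_pos (by linarith) _
  have h3 : Real.log x ≠ 0 := hlog.ne
  field_simp

lemma LD_mono {γ : ℝ} (h0 : 0 < γ) (h1 : γ ≤ 1) {x y : ℝ} (hx : 0 < x) (hxy : x ≤ y)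
    (hy : y ≤ 1 / 2) : LD γ x ≤ LD γ y := by
  have hb := beta_nonneg h0 h1
  have hv := vv_mono h0 h1 hx hxy hy
  have hvx := vv_pos γ hx (hxy.trans hy)
  have hlog : Real.log x ≤ Real.log y := Real.log_le_log hx hxy
  have h2 := abslog_ge (hx.trans_le hxy) hy
  have hl := log2_pos
  have h4 : |Real.log y| ≤ |Real.log x| := by
    have hyy : Real.log y ≤ 0 := Real.log_nonpos (by linarith) (by linarith)
    rw [abs_of_nonpos hyy, abs_of_nonpos (by linarith)]; linarith
  unfold LD
  have : 0 < |Real.log y| := by linarith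
  have hvy : 0 ≤ (1 / γ - 1) * vv γ y := mul_nonneg hb (by linarith)
  gcongr

lemma LD_ge {γ : ℝ} (h0 : 0 < γ) (h1 : γ ≤ 1) {x : ℝ} (hx : 0 < x)
    (hy : x ≤ 1 / 2) : 1 + vv γ x ≤ LD γ x := by
  have hb := beta_nonneg h0 h1
  have hvx := vv_pos γ hx hy
  unfold LD
  have : 0 ≤ (1 / γ - 1) * vv γ x / |Real.log x| := by positivity
  linarith

lemma LL_cont {γ : ℝ} (h0 : 0 < γ) (h1 : γ ≤ 1) : ContinuousOn (LL γ) (Icc 0 (1 / 2)) := by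
  intro x hx
  rcases hx.1.eq_or_lt with h | h
  · subst h
    unfold ContinuousWithinAt
    rw [LL_zero]
    have h2 : Tendsto (fun x : ℝ => 2 * x) (𝓝[Icc 0 (1 / 2)] 0) (𝓝 0) := by
      have : Continuous (fun x : ℝ => 2 * x) := by fun_prop
      simpa using (this.tendsto 0).mono_left nhdsWithin_le_nhds
    refine tendsto_of_tendsto_of_tendsto_of_le_of_le' tendsto_const_nhds h2 ?_ ?_
    · filter_upwards [self_mem_nhdsWithin] with y hy
      exact hy.1.trans (LL_le h0 h1 hy.1 hy.2).1
    · filter_upwards [self_mem_nhdsWithin] with y hy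
      exact (LL_le h0 h1 hy.1 hy.2).2
  · exact (LL_hasDerivAt γ h (by linarith [hx.2])).continuousAt.continuousWithinAt

lemma LL_convex {γ : ℝ} (h0 : 0 < γ) (h1 : γ ≤ 1) : ConvexOn ℝ (Icc 0 (1 / 2)) (LL γ) := by
  apply MonotoneOn.convexOn_of_deriv (convex_Icc _ _) (LL_cont h0 h1)
  · rw [interior_Icc]
    intro x hx
    exact (LL_hasDerivAt γ hx.1 (by linarith [hx.2])).differentiableAt.differentiableWithinAt
  · rw [interior_Icc]
    intro x hx y hy hxy
    rw [(LL_hasDerivAt γ hx.1 (by linarith [hx.2])).deriv,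
      (LL_hasDerivAt γ hy.1 (by linarith [hy.2])).deriv]
    exact LD_mono h0 h1 hx.1 hxy hy.2.le

lemma LL_lip {γ : ℝ} (h0 : 0 < γ) (h1 : γ ≤ 1) {x y : ℝ} (hx : 0 ≤ x) (hxy : x ≤ y)
    (hy : y ≤ 1 / 2) : LL γ y - LL γ x ≤ LD γ (1 / 2) * (y - x) := by
  refine Convex.image_sub_le_mul_sub_of_deriv_le (convex_Icc (0 : ℝ) (1 / 2)) (LL_cont h0 h1) ?_ ?_
    x ⟨hx, hxy.trans hy⟩ y ⟨hx.trans hxy, hy⟩ hxy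
  · rw [interior_Icc]
    intro x hx
    exact (LL_hasDerivAt γ hx.1 (by linarith [hx.2])).differentiableAt.differentiableWithinAt
  · rw [interior_Icc]
    intro x hx
    rw [(LL_hasDerivAt γ hx.1 (by linarith [hx.2])).deriv]
    exact LD_mono h0 h1 hx.1 hx.2.le le_rfl

lemma sqrt_ge {v : ℝ} (hv : 0 ≤ v) (hv1 : v ≤ 1) : 1 + v / 3 ≤ (1 + v) ^ (1 / 2 : ℝ) := by
  rw [← Real.sqrt_eq_rpow]
  apply Real.le_sqrt_of_sq_le
  nlinarith

lemma rpow34_ge {v : ℝ} (hv : 0 ≤ v) (hv1 : v ≤ 1) : 1 + v / 3 ≤ (1 + v) ^ (3 / 4 : ℝ) :=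
  (sqrt_ge hv hv1).trans (Real.rpow_le_rpow_of_exponent_le (by linarith) (by norm_num))

/-- left inverse branch -/
lemma exists_g {γ : ℝ} (h0 : 0 < γ) (h1 : γ ≤ 1) :
    ∃ g : ℝ → ℝ, ∀ y ∈ Icc (0 : ℝ) 1, g y ∈ Icc (0 : ℝ) (1 / 2) ∧ LL γ (g y) = y := by
  have := intermediate_value_Icc (by norm_num : (0 : ℝ) ≤ 1 / 2) (LL_cont h0 h1)
  rw [LL_zero, LL_half] at this
  have h : ∀ y : ℝ, ∃ x : ℝ, y ∈ Icc (0 : ℝ) 1 → x ∈ Icc (0 : ℝ) (1 / 2) ∧ LL γ x = y := by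
    intro y
    by_cases hy : y ∈ Icc (0 : ℝ) 1
    · obtain ⟨x, hx, hxy⟩ := this hy
      exact ⟨x, fun _ => ⟨hx, hxy⟩⟩
    · exact ⟨0, fun h => absurd h hy⟩
  choose g hg using h
  exact ⟨g, hg⟩

/-- transfer operator on distribution functions -/
noncomputable def Pop (g : ℝ → ℝ) : Module.End ℝ (ℝ → ℝ) where
  toFun F := fun y => F (g y) + F ((1 + y) / 2) - F (1 / 2)
  map_add' F G := by ext y; simp only [Pi.add_apply]; ring
  map_smul' a F := by ext y; simp only [Pi.smul_apply, smul_eq_mul, RingHom.id_apply]; ring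

lemma Pop_apply (g F : ℝ → ℝ) (y : ℝ) : Pop g F y = F (g y) + F ((1 + y) / 2) - F (1 / 2) := rfl

lemma Pop_succ (g F : ℝ → ℝ) (n : ℕ) : (Pop g ^ (n + 1)) F = Pop g ((Pop g ^ n) F) := by
  rw [pow_succ']; rfl

lemma Pop_add (g F : ℝ → ℝ) (m n : ℕ) : (Pop g ^ (m + n)) F = (Pop g ^ m) ((Pop g ^ n) F) := by
  rw [pow_add]; rfl

structure GoodG (g V : ℝ → ℝ) (Λ : ℝ) : Prop where
  maps : ∀ y ∈ Icc (0 : ℝ) 1, g y ∈ Icc (0 : ℝ) (1 / 2)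
  mono : MonotoneOn g (Icc 0 1)
  conc : ConcaveOn ℝ (Icc 0 1) g
  zero : g 0 = 0
  one : g 1 = 1 / 2
  Lpos : 0 < Λ
  lip : ∀ x ∈ Icc (0 : ℝ) 1, ∀ y ∈ Icc (0 : ℝ) 1, x ≤ y → y - x ≤ Λ * (g y - g x)
  Vnn : ∀ y ∈ Icc (0 : ℝ) 1, 0 ≤ V y
  Vineq : ∀ y ∈ Icc (0 : ℝ) 1, V (g y) + y ≤ V y
  Vle : ∀ y ∈ Icc (0 : ℝ) 1, y ≤ V y
  Vsmall : ∃ z, 0 < z ∧ z < 1 ∧ V z ≤ 1 / 4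

structure Dd (g F : ℝ → ℝ) : Prop where
  conc : ConcaveOn ℝ (Icc 0 1) F
  mono : MonotoneOn F (Icc 0 1)
  zero : F 0 = 0
  one : F 1 = 1
  lim : Tendsto (fun n => F (g^[n] 1)) atTop (𝓝 0)

section
variable {g V : ℝ → ℝ} {Λ : ℝ}

lemma GoodG.maps' (hg : GoodG g V Λ) {y : ℝ} (hy : y ∈ Icc (0 : ℝ) 1) : g y ∈ Icc (0 : ℝ) 1 :=
  ⟨(hg.maps y hy).1, (hg.maps y hy).2.trans (by norm_num)⟩

lemma GoodG.iter (hg : GoodG g V Λ) {y : ℝ} (hy : y ∈ Icc (0 : ℝ) 1) (n : ℕ) :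
    g^[n] y ∈ Icc (0 : ℝ) 1 := by
  induction n with
  | zero => simpa using hy
  | succ k ih => rw [Function.iterate_succ_apply']; exact hg.maps' ih

lemma one_mem' : (1 : ℝ) ∈ Icc (0 : ℝ) 1 := by simp

lemma half_mem' : (1 / 2 : ℝ) ∈ Icc (0 : ℝ) 1 := by constructor <;> norm_num

lemma zero_mem' : (0 : ℝ) ∈ Icc (0 : ℝ) 1 := by simp

lemma r_mem {y : ℝ} (hy : y ∈ Icc (0 : ℝ) 1) : (1 + y) / 2 ∈ Icc (0 : ℝ) 1 :=
  ⟨by linarith [hy.1], by linarith [hy.2]⟩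

lemma GoodG.lim (hg : GoodG g V Λ) : Tendsto (fun n => g^[n] 1) atTop (𝓝 0) := by
  have hs : Summable (fun n => g^[n] 1) := by
    refine summable_of_sum_range_le (c := V 1) (fun n => (hg.iter one_mem' n).1) (fun n => ?_)
    have : ∑ i ∈ Finset.range n, g^[i] 1 ≤ V 1 - V (g^[n] 1) := by
      induction n with
      | zero => simp
      | succ k ih =>
        rw [Finset.sum_range_succ, Function.iterate_succ_apply']
        have := hg.Vineq _ (hg.iter one_mem' k)
        linarith
    linarith [hg.Vnn _ (hg.iter one_mem' n)]
  exact hs.tendsto_atTop_zero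

/-- slope comparison for concave functions -/
lemma conc_slope {F : ℝ → ℝ} (hF : ConcaveOn ℝ (Icc 0 1) F) {a b c d : ℝ} (ha : 0 ≤ a)
    (hab : a < b) (hbc : b ≤ c) (hcd : c < d) (hd : d ≤ 1) :
    (F d - F c) / (d - c) ≤ (F b - F a) / (b - a) := by
  rcases hbc.eq_or_lt with h | h
  · subst h
    exact hF.slope_anti_adjacent ⟨ha, by linarith⟩ ⟨by linarith, hd⟩ hab hcd
  · have h1 := hF.slope_anti_adjacent (x := a) (y := b) (z := c) ⟨ha, by linarith⟩
      ⟨by linarith, by linarith⟩ hab h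
    have h2 := hF.slope_anti_adjacent (x := b) (y := c) (z := d) ⟨by linarith, by linarith⟩
      ⟨by linarith, by linarith⟩ h hcd
    exact h2.trans h1

/-- increments bounded by `F a / a`. -/
lemma conc_incr {F : ℝ → ℝ} (hF : ConcaveOn ℝ (Icc 0 1) F) (h0 : F 0 = 0) {a b : ℝ} (ha : 0 < a)
    (hab : a ≤ b) (hb : b ≤ 1) : F b - F a ≤ F a / a * (b - a) := by
  rcases hab.eq_or_lt with h | h
  · subst h; simp
  · have := conc_slope hF le_rfl ha le_rfl h hb
    rw [h0, sub_zero, sub_zero, div_le_iff₀ (by linarith)] at this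
    exact this

lemma Dd.nonneg {F : ℝ → ℝ} (hF : Dd g F) {y : ℝ} (hy : y ∈ Icc (0 : ℝ) 1) : 0 ≤ F y := by
  rw [← hF.zero]; exact hF.mono zero_mem' hy hy.1

lemma Dd.le_one {F : ℝ → ℝ} (hF : Dd g F) {y : ℝ} (hy : y ∈ Icc (0 : ℝ) 1) : F y ≤ 1 := by
  rw [← hF.one]; exact hF.mono hy one_mem' hy.2

lemma Dd.right {F : ℝ → ℝ} (hF : Dd g F) {y : ℝ} (hy : y ∈ Icc (0 : ℝ) 1) :
    F ((1 + y) / 2) - F (1 / 2) ≤ y := by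
  have h1 := conc_incr hF.conc hF.zero (by norm_num : (0 : ℝ) < 1 / 2)
    (by linarith [hy.1] : 1 / 2 ≤ (1 + y) / 2) (r_mem hy).2
  have h2 := hF.le_one half_mem'
  have := hy.1
  nlinarith

lemma Dd.right_nonneg {F : ℝ → ℝ} (hF : Dd g F) {y : ℝ} (hy : y ∈ Icc (0 : ℝ) 1) :
    0 ≤ F ((1 + y) / 2) - F (1 / 2) := by
  have := hF.mono half_mem' (r_mem hy) (by linarith [hy.1])
  linarith

lemma Dd.pop (hg : GoodG g V Λ) {F : ℝ → ℝ} (hF : Dd g F) : Dd g (Pop g F) := by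
  refine ⟨⟨convex_Icc _ _, ?_⟩, ?_, ?_, ?_, ?_⟩
  · intro x hx y hy a b ha hb hab
    simp only [Pop_apply, smul_eq_mul]
    have hmem : a * x + b * y ∈ Icc (0 : ℝ) 1 := by
      have := (convex_Icc (0 : ℝ) 1) hx hy ha hb hab
      simpa using this
    have hmem2 : a * g x + b * g y ∈ Icc (0 : ℝ) 1 := by
      have := (convex_Icc (0 : ℝ) 1) (hg.maps' hx) (hg.maps' hy) ha hb hab
      simpa using this
    have h1 := hg.conc.2 hx hy ha hb hab
    simp only [smul_eq_mul] at h1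
    have h2 := hF.mono hmem2 (hg.maps' hmem) h1
    have h3 := hF.conc.2 (hg.maps' hx) (hg.maps' hy) ha hb hab
    simp only [smul_eq_mul] at h3
    have h4 := hF.conc.2 (r_mem hx) (r_mem hy) ha hb hab
    simp only [smul_eq_mul] at h4
    have h5 : a * ((1 + x) / 2) + b * ((1 + y) / 2) = (1 + (a * x + b * y)) / 2 := by
      have : b = 1 - a := by linarith
      subst this; ring
    rw [h5] at h4
    have h6 : F (1 / 2) = a * F (1 / 2) + b * F (1 / 2) := by rw [← add_mul, hab, one_mul]
    rw [mul_sub, mul_sub, mul_add, mul_add]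
    linarith
  · intro x hx y hy hxy
    simp only [Pop_apply]
    have h1 := hF.mono (hg.maps' hx) (hg.maps' hy) (hg.mono hx hy hxy)
    have h2 := hF.mono (r_mem hx) (r_mem hy) (by linarith)
    linarith
  · simp [Pop_apply, hg.zero, hF.zero]
  · simp [Pop_apply, hg.one, hF.one]
  · have h1 : Tendsto (fun n => F (g^[n + 1] 1) + g^[n] 1) atTop (𝓝 0) := by
      simpa using ((tendsto_add_atTop_iff_nat 1).2 hF.lim).add hg.lim
    refine tendsto_of_tendsto_of_tendsto_of_le_of_le tendsto_const_nhds h1 ?_ ?_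
    · intro n
      have h2 := hF.nonneg (hg.maps' (hg.iter one_mem' n))
      have h3 := hF.right_nonneg (hg.iter one_mem' n)
      simp only [Pop_apply]
      linarith
    · intro n
      have h3 := hF.right (hg.iter one_mem' n)
      simp only [Pop_apply, Function.iterate_succ_apply']
      linarith

lemma Dd.pops (hg : GoodG g V Λ) {F : ℝ → ℝ} (hF : Dd g F) (n : ℕ) : Dd g ((Pop g ^ n) F) := by
  induction n with
  | zero => simpa using hF
  | succ k ih => rw [Pop_succ]; exact ih.pop hg

lemma Dd.upper (hg : GoodG g V Λ) {F : ℝ → ℝ} (hF : Dd g F) (n : ℕ) {y : ℝ}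
    (hy : y ∈ Icc (0 : ℝ) 1) : (Pop g ^ n) F y ≤ F (g^[n] y) + V y := by
  induction n generalizing y with
  | zero => simpa using hg.Vnn y hy
  | succ k ih =>
    rw [Pop_succ, Pop_apply]
    have h1 := ih (hg.maps' hy)
    have h2 := (hF.pops hg k).right hy
    have h3 := hg.Vineq y hy
    rw [Function.iterate_succ_apply]
    linarith

lemma GoodG.iter_mono (hg : GoodG g V Λ) {x y : ℝ} (hx : x ∈ Icc (0 : ℝ) 1)
    (hy : y ∈ Icc (0 : ℝ) 1) (hxy : x ≤ y) (n : ℕ) : g^[n] x ≤ g^[n] y := by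
  induction n with
  | zero => simpa using hxy
  | succ k ih =>
    rw [Function.iterate_succ_apply', Function.iterate_succ_apply']
    exact hg.mono (hg.iter hx k) (hg.iter hy k) ih

lemma id_upper (hg : GoodG g V Λ) (hid : Dd g id) (n : ℕ) {y : ℝ}
    (hy : y ∈ Icc (0 : ℝ) 1) : (Pop g ^ n) id y ≤ V y := by
  induction n generalizing y with
  | zero => simpa using hg.Vle y hy
  | succ k ih =>
    rw [Pop_succ, Pop_apply]
    have h1 := ih (hg.maps' hy)
    have h2 := (hid.pops hg k).right hy
    have h3 := hg.Vineq y hy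
    linarith

lemma Dd_id (hg : GoodG g V Λ) : Dd g id :=
  ⟨concaveOn_id (convex_Icc _ _), fun _ _ _ _ h => h, rfl, rfl, hg.lim⟩

/-- slope propagation -/
lemma slope_prop (hg : GoodG g V Λ) {F : ℝ → ℝ} (hF : Dd g F) {l : ℝ} (hl : 0 ≤ l) (k : ℕ)
    (hsl : ∀ a b, 0 ≤ a → a ≤ b → b ≤ g^[k] 1 → l * (b - a) ≤ F b - F a) :
    ∀ a b, 0 ≤ a → a ≤ b → b ≤ 1 → l / Λ ^ k * (b - a) ≤ (Pop g ^ k) F b - (Pop g ^ k) F a := by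
  suffices H : ∀ j, j ≤ k → ∀ a b, 0 ≤ a → a ≤ b → b ≤ g^[k - j] 1 →
      l / Λ ^ j * (b - a) ≤ (Pop g ^ j) F b - (Pop g ^ j) F a by
    intro a b ha hab hb
    exact H k le_rfl a b ha hab (by simpa using hb)
  intro j
  induction j with
  | zero =>
    intro _ a b ha hab hb
    simpa using hsl a b ha hab hb
  | succ j ih =>
    intro hj a b ha hab hb
    have hb1 : b ≤ 1 := hb.trans (hg.iter one_mem' _).2
    have hbm : b ∈ Icc (0 : ℝ) 1 := ⟨ha.trans hab, hb1⟩
    have ham : a ∈ Icc (0 : ℝ) 1 := ⟨ha, hab.trans hb1⟩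
    have hgb : g b ≤ g^[k - j] 1 := by
      have : k - j = (k - (j + 1)) + 1 := by omega
      rw [this, Function.iterate_succ_apply']
      exact hg.mono hbm (hg.iter one_mem' _) hb
    have h1 := ih (by omega) (g a) (g b) (hg.maps' ham).1 (hg.mono ham hbm hab) hgb
    have h2 := (hF.pops hg j).mono (r_mem ham) (r_mem hbm) (by linarith)
    have h3 := hg.lip a ham b hbm hab
    have hL := hg.Lpos
    rw [Pop_succ, Pop_apply, Pop_apply]
    have h4 : l / Λ ^ (j + 1) * (b - a) ≤ l / Λ ^ j * (g b - g a) := by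
      have : l / Λ ^ (j + 1) * (b - a) ≤ l / Λ ^ (j + 1) * (Λ * (g b - g a)) := by gcongr
      refine this.trans (le_of_eq ?_)
      rw [pow_succ]
      field_simp
    linarith

lemma minor (hg : GoodG g V Λ) : ∃ c : ℝ, 0 < c ∧ c < 1 ∧ ∀ F, Dd g F → ∃ N, ∀ m, N ≤ m →
    ∀ a b, 0 ≤ a → a ≤ b → b ≤ 1 → c * (b - a) ≤ (Pop g ^ m) F b - (Pop g ^ m) F a := by
  obtain ⟨z, hz0, hz1, hVz⟩ := hg.Vsmall
  have hzm : z ∈ Icc (0 : ℝ) 1 := ⟨hz0.le, hz1.le⟩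
  obtain ⟨k, hk⟩ := (hg.lim.eventually (gt_mem_nhds hz0)).exists
  have hL := hg.Lpos
  have hcp : 0 < (1 / 2) / Λ ^ k := by positivity
  refine ⟨min ((1 / 2) / Λ ^ k) (1 / 2), lt_min hcp (by norm_num),
    (min_le_right _ _).trans_lt (by norm_num), fun F hF => ?_⟩
  obtain ⟨N, hN⟩ := eventually_atTop.1 (hF.lim.eventually (gt_mem_nhds (by norm_num : (0 : ℝ) < 1 / 4)))
  refine ⟨N + k, fun m hm a b ha hab hb => ?_⟩
  obtain ⟨n, rfl⟩ : ∃ n, m = k + n := ⟨m - k, by omega⟩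
  have hn : N ≤ n := by omega
  have hFn := hF.pops hg n
  have hup : (Pop g ^ n) F z ≤ 1 / 2 := by
    have h1 := hF.upper hg n hzm
    have h2 := hF.mono (hg.iter hzm n) (hg.iter one_mem' n) (hg.iter_mono hzm one_mem' hz1.le n)
    have h3 := hN n hn
    linarith
  have hsl : ∀ a b, 0 ≤ a → a ≤ b → b ≤ g^[k] 1 →
      1 / 2 * (b - a) ≤ (Pop g ^ n) F b - (Pop g ^ n) F a := by
    intro a b ha hab hb
    rcases hab.eq_or_lt with h | h
    · subst h; simp
    · have h1 := conc_slope hFn.conc ha h (hb.trans hk.le) hz1 le_rfl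
      rw [hFn.one] at h1
      have h2 : 1 / 2 ≤ (1 - (Pop g ^ n) F z) / (1 - z) := by
        rw [le_div_iff₀ (by linarith)]; nlinarith
      have h3 := h2.trans h1
      rwa [le_div_iff₀ (by linarith)] at h3
  have := slope_prop hg hFn (by norm_num) k hsl a b ha hab hb
  rw [Pop_add]
  refine le_trans ?_ this
  have : 0 ≤ b - a := by linarith
  gcongr
  exact min_le_left _ _

lemma Dd.sub_c {F : ℝ → ℝ} (hg : GoodG g V Λ) (hF : Dd g F) {c : ℝ} (hc : c < 1)
    (hsl : ∀ a b, 0 ≤ a → a ≤ b → b ≤ 1 → c * (b - a) ≤ F b - F a) :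
    Dd g ((1 - c)⁻¹ • (F - c • id)) := by
  have hc' : 0 < (1 - c)⁻¹ := by rw [inv_pos]; linarith
  refine ⟨?_, ?_, ?_, ?_, ?_⟩
  · refine ConcaveOn.smul hc'.le ⟨convex_Icc _ _, ?_⟩
    intro x hx y hy a b ha hb hab
    have := hF.conc.2 hx hy ha hb hab
    simp only [smul_eq_mul, Pi.sub_apply, Pi.smul_apply, id] at this ⊢
    linarith
  · intro x hx y hy hxy
    have := hsl x y hx.1 hxy hy.2
    simp only [smul_eq_mul, Pi.sub_apply, Pi.smul_apply, id]
    apply mul_le_mul_of_nonneg_left _ hc'.le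
    linarith
  · simp [hF.zero]
  · simp only [smul_eq_mul, Pi.sub_apply, Pi.smul_apply, id, hF.one]
    rw [mul_one, inv_mul_cancel₀ (by linarith)]
  · have := (hF.lim.sub (hg.lim.const_mul c)).const_mul (1 - c)⁻¹
    simpa using this

lemma couple (hg : GoodG g V Λ) {c : ℝ} (hc1 : c < 1)
    (hc : ∀ F, Dd g F → ∃ N, ∀ m, N ≤ m →
      ∀ a b, 0 ≤ a → a ≤ b → b ≤ 1 → c * (b - a) ≤ (Pop g ^ m) F b - (Pop g ^ m) F a) (j : ℕ) :
    ∀ F G, Dd g F → Dd g G → ∃ N, ∀ n, N ≤ n → ∀ y ∈ Icc (0 : ℝ) 1,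
      |(Pop g ^ n) F y - (Pop g ^ n) G y| ≤ (1 - c) ^ j := by
  induction j with
  | zero =>
    intro F G hF hG
    refine ⟨0, fun n _ y hy => ?_⟩
    have h1 := (hF.pops hg n).nonneg hy
    have h2 := (hF.pops hg n).le_one hy
    have h3 := (hG.pops hg n).nonneg hy
    have h4 := (hG.pops hg n).le_one hy
    rw [pow_zero, abs_le]; constructor <;> linarith
  | succ j ih =>
    intro F G hF hG
    obtain ⟨N1, hN1⟩ := hc F hF
    obtain ⟨N2, hN2⟩ := hc G hG
    set M := max N1 N2
    have hF' := (hF.pops hg M).sub_c hg hc1 (hN1 M (le_max_left _ _))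
    have hG' := (hG.pops hg M).sub_c hg hc1 (hN2 M (le_max_right _ _))
    obtain ⟨N, hN⟩ := ih _ _ hF' hG'
    refine ⟨N + M, fun n hn y hy => ?_⟩
    obtain ⟨k, rfl⟩ : ∃ k, n = k + M := ⟨n - M, by omega⟩
    have h1 := hN k (by omega) y hy
    rw [← Pi.sub_apply, ← map_sub, ← smul_sub, sub_sub_sub_cancel_right, map_smul, map_sub,
      ← Pop_add, ← Pop_add, Pi.smul_apply, smul_eq_mul, abs_mul, Pi.sub_apply] at h1
    have hp : 0 < 1 - c := by linarith
    rw [abs_of_pos (inv_pos.2 hp), inv_mul_le_iff₀ hp] at h1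
    rw [pow_succ']
    exact h1

lemma couple_lim (hg : GoodG g V Λ) {F G : ℝ → ℝ} (hF : Dd g F) (hG : Dd g G) {y : ℝ}
    (hy : y ∈ Icc (0 : ℝ) 1) :
    Tendsto (fun n => (Pop g ^ n) F y - (Pop g ^ n) G y) atTop (𝓝 0) := by
  obtain ⟨c, hc0, hc1, hc⟩ := minor hg
  rw [Metric.tendsto_atTop]
  intro ε hε
  obtain ⟨j, hj⟩ := exists_pow_lt_of_lt_one hε (by linarith : 1 - c < 1)
  obtain ⟨N, hN⟩ := couple hg hc1 hc j F G hF hG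
  refine ⟨N, fun n hn => ?_⟩
  rw [Real.dist_eq, sub_zero]
  exact (hN n hn y hy).trans_lt hj

end

lemma exists_goodG {γ : ℝ} (h0 : 0 < γ) (h1 : γ ≤ 1) :
    ∃ (g : ℝ → ℝ) (A Λ : ℝ), 1 ≤ A ∧ GoodG g (fun y => A * y ^ (3 / 4 : ℝ)) Λ ∧
      ∀ y ∈ Icc (0 : ℝ) 1, g y ∈ Icc (0 : ℝ) (1 / 2) ∧ LL γ (g y) = y := by
  obtain ⟨g, hg⟩ := exists_g h0 h1
  obtain ⟨K, hK1, hK⟩ := vv_key h0 h1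
  have hsm := LL_strictMono h0 h1
  have hmono : MonotoneOn g (Icc 0 1) := by
    intro x hx y hy hxy
    rw [← hsm.le_iff_le (hg x hx).1 (hg y hy).1, (hg x hx).2, (hg y hy).2]
    exact hxy
  have hVle : ∀ y ∈ Icc (0 : ℝ) 1, y ≤ y ^ (3 / 4 : ℝ) := by
    intro y hy
    have := Real.rpow_le_rpow_of_exponent_ge' hy.1 hy.2 (by norm_num : (0 : ℝ) ≤ 3 / 4)
      (by norm_num : (3 / 4 : ℝ) ≤ 1)
    simpa using this
  refine ⟨g, 6 * K, LD γ (1 / 2), by linarith, ⟨fun y hy => (hg y hy).1, hmono,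
    ⟨convex_Icc _ _, ?_⟩, ?_, ?_, ?_, ?_, ?_, ?_, ?_, ?_⟩, hg⟩
  · intro x hx y hy a b ha hb hab
    have hmem := (convex_Icc (0 : ℝ) 1) hx hy ha hb hab
    have hmem2 := (convex_Icc (0 : ℝ) (1 / 2)) (hg x hx).1 (hg y hy).1 ha hb hab
    rw [← hsm.le_iff_le hmem2 (hg _ hmem).1, (hg _ hmem).2]
    have := (LL_convex h0 h1).2 (hg x hx).1 (hg y hy).1 ha hb hab
    rwa [(hg x hx).2, (hg y hy).2] at this
  · apply hsm.injOn (hg 0 zero_mem').1 (by constructor <;> norm_num)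
    rw [(hg 0 zero_mem').2, LL_zero]
  · apply hsm.injOn (hg 1 one_mem').1 (by constructor <;> norm_num)
    rw [(hg 1 one_mem').2, LL_half]
  · have := LD_ge h0 h1 (by norm_num : (0 : ℝ) < 1 / 2) le_rfl
    rw [vv_half] at this
    linarith
  · intro x hx y hy hxy
    have := LL_lip h0 h1 (hg x hx).1.1 (hmono hx hy hxy) (hg y hy).1.2
    rwa [(hg x hx).2, (hg y hy).2] at this
  · intro y hy
    have := hy.1
    positivity
  · intro y hy
    obtain ⟨⟨ha, hb⟩, hc⟩ := hg y hy
    generalize g y = x at *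
    subst hc
    rcases ha.eq_or_lt with h | h
    · rw [← h, LL_zero]; simp
    · have hv := vv_pos γ h hb
      have hv1 := vv_le_one h0 h1 h hb
      have h2 := (LL_le h0 h1 h.le hb).2
      have h3 := rpow34_ge hv.le hv1
      have h4 := hK x h hb
      have h5 : (LL γ x) ^ (3 / 4 : ℝ) = x ^ (3 / 4 : ℝ) * (1 + vv γ x) ^ (3 / 4 : ℝ) := by
        rw [LL, Real.mul_rpow h.le (by linarith)]
      rw [h5]
      have h6 : x ≤ x ^ (3 / 4 : ℝ) * (K * vv γ x) := by
        have e1 : x ^ (1 / 4 : ℝ) ≤ x ^ (1 / 8 : ℝ) :=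
          Real.rpow_le_rpow_of_exponent_ge h (by linarith) (by norm_num)
        have e2 : x = x ^ (3 / 4 : ℝ) * x ^ (1 / 4 : ℝ) := by
          rw [← Real.rpow_add h]; norm_num
        calc x = x ^ (3 / 4 : ℝ) * x ^ (1 / 4 : ℝ) := e2
          _ ≤ _ := by
            apply mul_le_mul_of_nonneg_left (e1.trans h4) (by positivity)
      have h7 : 6 * K * (x ^ (3 / 4 : ℝ) * (1 + vv γ x / 3)) ≤
          6 * K * (x ^ (3 / 4 : ℝ) * (1 + vv γ x) ^ (3 / 4 : ℝ)) := by gcongr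
      refine le_trans ?_ h7
      nlinarith
  · intro y hy
    have := hVle y hy
    nlinarith [hy.1]
  · have hc : Tendsto (fun y : ℝ => 6 * K * y ^ (3 / 4 : ℝ)) (𝓝[>] 0) (𝓝 0) := by
      have : ContinuousAt (fun y : ℝ => 6 * K * y ^ (3 / 4 : ℝ)) 0 :=
        (Real.continuousAt_rpow_const 0 (3 / 4) (Or.inr (by norm_num))).const_mul _
      have h := this.tendsto
      rw [Real.zero_rpow (by norm_num), mul_zero] at h
      exact h.mono_left nhdsWithin_le_nhds
    have h1 := hc.eventually (ge_mem_nhds (by norm_num : (0 : ℝ) < 1 / 4))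
    have h2 : ∀ᶠ z : ℝ in 𝓝[>] 0, z ∈ Ioo (0 : ℝ) 1 := Ioo_mem_nhdsGT (by norm_num)
    obtain ⟨z, hz1, hz2⟩ := (h1.and h2).exists
    exact ⟨z, hz2.1, hz2.2, hz1⟩

lemma Tmap_measurable (γ : ℝ) : Measurable (Tmap γ) := by
  unfold Tmap
  refine Measurable.ite measurableSet_Iic measurable_const
    (Measurable.ite measurableSet_Iic ?_ (by fun_prop))
  have h : Measurable (fun x : ℝ => |Real.log x| ^ (1 / γ - 1)) := by fun_prop
  fun_prop

lemma Tmap_right (γ : ℝ) {x : ℝ} (hx : 1 / 2 < x) : Tmap γ x = 2 * x - 1 := by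
  unfold Tmap
  rw [if_neg (by linarith), if_neg (by linarith)]

lemma Tmap_maps {γ : ℝ} (h0 : 0 < γ) (h1 : γ ≤ 1) {x : ℝ} (hx : x ∈ Ioc (0 : ℝ) 1) :
    Tmap γ x ∈ Ioc (0 : ℝ) 1 := by
  by_cases h : x ≤ 1 / 2
  · rw [Tmap_eq_LL γ hx.1.le h]
    have := LL_le h0 h1 hx.1.le h
    exact ⟨by linarith [hx.1], by linarith⟩
  · push Not at h
    rw [Tmap_right γ h]
    exact ⟨by linarith, by linarith [hx.2]⟩

lemma Tmap_iter {γ : ℝ} (h0 : 0 < γ) (h1 : γ ≤ 1) {x : ℝ} (hx : x ∈ Ioc (0 : ℝ) 1) (n : ℕ) :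
    (Tmap γ)^[n] x ∈ Ioc (0 : ℝ) 1 := by
  induction n with
  | zero => simpa using hx
  | succ k ih => rw [Function.iterate_succ_apply']; exact Tmap_maps h0 h1 ih

def EE (γ : ℝ) (n : ℕ) (y : ℝ) : Set ℝ := Ioc 0 1 ∩ (Tmap γ)^[n] ⁻¹' Ioc 0 y

lemma EE_meas (γ : ℝ) (n : ℕ) (y : ℝ) : MeasurableSet (EE γ n y) :=
  measurableSet_Ioc.inter (((Tmap_measurable γ).iterate n) measurableSet_Ioc)

lemma EE_subI (γ : ℝ) (n : ℕ) (y : ℝ) : EE γ n y ⊆ Ioc 0 1 := inter_subset_left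

lemma EE_sub (γ : ℝ) (n : ℕ) {y z : ℝ} (h : y ≤ z) : EE γ n y ⊆ EE γ n z :=
  fun _ hx => ⟨hx.1, hx.2.1, hx.2.2.trans h⟩

section
variable {γ : ℝ} {g : ℝ → ℝ} (h0 : 0 < γ) (h1 : γ ≤ 1)
  (hg : ∀ y ∈ Icc (0 : ℝ) 1, g y ∈ Icc (0 : ℝ) (1 / 2) ∧ LL γ (g y) = y)
include h0 h1 hg

lemma EE_succ (n : ℕ) {y : ℝ} (hy : y ∈ Icc (0 : ℝ) 1) :
    EE γ (n + 1) y = EE γ n (g y) ∪ (EE γ n ((1 + y) / 2) \ EE γ n (1 / 2)) := by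
  ext x
  simp only [EE, mem_inter_iff, mem_preimage, mem_union, Set.mem_sdiff, Function.iterate_succ_apply']
  by_cases hx : x ∈ Ioc (0 : ℝ) 1
  swap
  · simp [hx]
  have hw := Tmap_iter h0 h1 hx n
  simp only [hx, true_and]
  generalize (Tmap γ)^[n] x = w at *
  obtain ⟨hgy, hgy2⟩ := hg y hy
  by_cases h : w ≤ 1 / 2
  · rw [Tmap_eq_LL γ hw.1.le h]
    have e : LL γ w ≤ y ↔ w ≤ g y := by
      rw [← (LL_strictMono h0 h1).le_iff_le ⟨hw.1.le, h⟩ hgy, hgy2]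
    have := (LL_le h0 h1 hw.1.le h).1
    have hp : 0 < LL γ w := by linarith [hw.1]
    simp only [mem_Ioc, e, hp, hw.1, h, true_and, not_true, and_false, or_false]
  · push Not at h
    rw [Tmap_right γ h]
    have e1 : ¬ w ≤ g y := by linarith [hgy.2]
    have e2 : ¬ w ≤ 1 / 2 := by linarith
    have e3 : 0 < 2 * w - 1 := by linarith
    have e4 : 2 * w - 1 ≤ y ↔ w ≤ (1 + y) / 2 := by constructor <;> intro <;> linarith
    simp only [mem_Ioc, e1, e2, e3, e4, hw.1, true_and, and_false, false_or, not_false_iff, and_true]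

lemma Phi_eq {h : ℝ → ℝ} (hh : IntegrableOn h (Ioc 0 1)) (n : ℕ) {y : ℝ}
    (hy : y ∈ Icc (0 : ℝ) 1) :
    ∫ x in EE γ n y, h x = (Pop g ^ n) (fun y => ∫ x in Ioc 0 y, h x) y := by
  have hIntg : ∀ n z, IntegrableOn h (EE γ n z) := fun n z => hh.mono_set inter_subset_left
  induction n generalizing y with
  | zero =>
    have : EE γ 0 y = Ioc 0 y := by
      unfold EE
      simp only [Function.iterate_zero, preimage_id]
      exact inter_eq_right.2 (Ioc_subset_Ioc_right hy.2)
    rw [this]; simp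
  | succ k ih =>
    obtain ⟨hgy, hgy2⟩ := hg y hy
    rw [EE_succ h0 h1 hg k hy, Pop_succ, Pop_apply, ← ih ⟨hgy.1, hgy.2.trans (by norm_num)⟩,
      ← ih (r_mem hy), ← ih half_mem', setIntegral_union _ ((EE_meas _ _ _).diff (EE_meas _ _ _))
      (hIntg _ _) ((hIntg _ _).mono_set sdiff_subset), setIntegral_sdiff (EE_meas _ _ _) (hIntg _ _)
      (EE_sub _ _ (by linarith [hy.1]))]
    · ring
    · rw [Set.disjoint_left]
      intro x hx hx2
      exact hx2.2 (EE_sub _ _ hgy.2 hx)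

end

lemma Dd.congr {g V : ℝ → ℝ} {Λ : ℝ} (hg : GoodG g V Λ) {F G : ℝ → ℝ} (hF : Dd g F)
    (h : ∀ y ∈ Icc (0 : ℝ) 1, F y = G y) : Dd g G := by
  refine ⟨hF.conc.congr h, hF.mono.congr h, ?_, ?_, ?_⟩
  · rw [← h 0 zero_mem', hF.zero]
  · rw [← h 1 one_mem', hF.one]
  · refine hF.lim.congr fun n => h _ (hg.iter one_mem' n)

section
variable {γ : ℝ} {g V : ℝ → ℝ} {Λ : ℝ} (h0 : 0 < γ) (h1 : γ ≤ 1) (hG : GoodG g V Λ)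
  (hg : ∀ y ∈ Icc (0 : ℝ) 1, g y ∈ Icc (0 : ℝ) (1 / 2) ∧ LL γ (g y) = y)

lemma int_mono (k : ℕ) {y : ℝ} (hy : 0 ≤ y) :
    ∫ x in Ioc 0 y, x ^ k = y ^ (k + 1) / (k + 1) := by
  rw [← intervalIntegral.integral_of_le hy, integral_pow]; simp

lemma pow_intOn (k : ℕ) (a b : ℝ) : IntegrableOn (fun x : ℝ => x ^ k) (Ioc a b) :=
  (Continuous.integrableOn_Icc (by fun_prop)).mono_set Ioc_subset_Icc_self

include hG in
lemma Dd_mono (k : ℕ) (hk : 1 ≤ k) :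
    Dd g (((k + 1 : ℝ) / k) • fun y => ∫ x in Ioc 0 y, (1 - x ^ k)) := by
  have hk0 : (0 : ℝ) < k := by exact_mod_cast hk
  have e : ∀ y ∈ Icc (0 : ℝ) 1, y - y ^ (k + 1) / (k + 1) = ∫ x in Ioc 0 y, (1 - x ^ k) := by
    intro y hy
    rw [integral_sub (by simp) (pow_intOn k 0 y), int_mono k hy.1]
    simp [hy.1]
  have hp : (0 : ℝ) ≤ (k + 1 : ℝ) / k := by positivity
  refine ⟨ConcaveOn.smul hp (ConcaveOn.congr ⟨convex_Icc _ _, ?_⟩ e), ?_, ?_, ?_, ?_⟩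
  · intro x hx y hy a b ha hb hab
    have := (convexOn_pow (𝕜 := ℝ) (k + 1)).2 hx.1 hy.1 ha hb hab
    simp only [smul_eq_mul] at this ⊢
    have h2 : (a * x + b * y) ^ (k + 1) / (k + 1 : ℝ) ≤
      (a * x ^ (k + 1) + b * y ^ (k + 1)) / (k + 1) := by gcongr
    have h3 : (a * x ^ (k + 1) + b * y ^ (k + 1)) / (k + 1 : ℝ) =
      a * (x ^ (k + 1) / (k + 1)) + b * (y ^ (k + 1) / (k + 1)) := by ring
    linarith
  · intro x hx y hy hxy
    simp only [Pi.smul_apply, smul_eq_mul]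
    apply mul_le_mul_of_nonneg_left _ hp
    apply setIntegral_mono_set
    · exact (Continuous.integrableOn_Icc (by fun_prop)).mono_set Ioc_subset_Icc_self
    · rw [EventuallyLE, ae_restrict_iff' measurableSet_Ioc]
      filter_upwards with z hz
      have := pow_le_one₀ (n := k) hz.1.le (hz.2.trans hy.2)
      simp only [Pi.zero_apply]; linarith
    · exact (Ioc_subset_Ioc_right hxy).eventuallyLE
  · simp
  · simp only [Pi.smul_apply, smul_eq_mul]
    rw [← e 1 one_mem']
    field_simp
    simp
  · have h : Tendsto (fun n => ((k + 1 : ℝ) / k) * (g^[n] 1 - (g^[n] 1) ^ (k + 1) / (k + 1)))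
        atTop (𝓝 (((k + 1 : ℝ) / k) * (0 - 0 ^ (k + 1) / (k + 1)))) :=
      (hG.lim.sub ((hG.lim.pow _).div_const _)).const_mul _
    simp only [ne_eq, Nat.add_eq_zero_iff, one_ne_zero, and_false, not_false_eq_true, zero_pow,
      zero_div, sub_zero, mul_zero] at h
    refine h.congr fun n => ?_
    simp only [Pi.smul_apply, smul_eq_mul]
    rw [e _ (hG.iter one_mem' n)]

include h0 h1 hG hg in
lemma mix_mono (k : ℕ) {y : ℝ} (hy : y ∈ Icc (0 : ℝ) 1) :
    Tendsto (fun n => (∫ x in EE γ n y, x ^ k) - (∫ x in Ioc (0 : ℝ) 1, x ^ k) *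
      ∫ _x in EE γ n y, (1 : ℝ)) atTop (𝓝 0) := by
  rcases Nat.eq_zero_or_pos k with hk | hk
  · subst hk
    simp
  have hk0 : (0 : ℝ) < k := by exact_mod_cast hk
  have hid : Dd g (fun y => ∫ _x in Ioc 0 y, (1 : ℝ)) :=
    (Dd_id hG).congr hG (fun y hy => by simp [hy.1])
  have hm := (couple_lim hG (Dd_mono hG k hk) hid hy).const_mul (-(k : ℝ) / (k + 1))
  rw [mul_zero] at hm
  refine hm.congr fun n => ?_
  have i1 : IntegrableOn (fun _ : ℝ => (1 : ℝ)) (Ioc 0 1) := by simp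
  have i2 := pow_intOn k 0 1
  have i3 : IntegrableOn (fun x : ℝ => 1 - x ^ k) (Ioc 0 1) := i1.sub i2
  rw [map_smul, Pi.smul_apply, ← Phi_eq h0 h1 hg i1 n hy, ← Phi_eq h0 h1 hg i3 n hy,
    integral_sub (i1.mono_set (EE_subI γ n y)) (i2.mono_set (EE_subI γ n y)),
    int_mono k zero_le_one]
  simp only [smul_eq_mul, one_pow]
  field_simp
  ring

include h0 h1 hG hg in
lemma mix_poly (p : Polynomial ℝ) {y : ℝ} (hy : y ∈ Icc (0 : ℝ) 1) :
    Tendsto (fun n => (∫ x in EE γ n y, p.eval x) - (∫ x in Ioc (0 : ℝ) 1, p.eval x) *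
      ∫ _x in EE γ n y, (1 : ℝ)) atTop (𝓝 0) := by
  have hi : ∀ p : Polynomial ℝ, IntegrableOn (fun x => p.eval x) (Ioc (0 : ℝ) 1) := fun p =>
    (Continuous.integrableOn_Icc (by fun_prop)).mono_set Ioc_subset_Icc_self
  induction p using Polynomial.induction_on' with
  | add p q hp hq =>
    have := hp.add hq
    rw [add_zero] at this
    refine this.congr fun n => ?_
    simp only [Polynomial.eval_add]
    rw [integral_add (hi p) (hi q), integral_add ((hi p).mono_set (EE_subI γ n y))
      ((hi q).mono_set (EE_subI γ n y))]
    ring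
  | monomial k a =>
    have := (mix_mono h0 h1 hG hg k hy).const_mul a
    rw [mul_zero] at this
    refine this.congr fun n => ?_
    simp only [Polynomial.eval_monomial, integral_const_mul]
    ring

include h0 h1 hG hg in
lemma mix_int {h : ℝ → ℝ} (hh : IntegrableOn h (Ioc 0 1)) {y : ℝ} (hy : y ∈ Icc (0 : ℝ) 1) :
    Tendsto (fun n => (∫ x in EE γ n y, h x) - (∫ x in Ioc (0 : ℝ) 1, h x) *
      ∫ _x in EE γ n y, (1 : ℝ)) atTop (𝓝 0) := by
  rw [Metric.tendsto_atTop]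
  intro ε hε
  obtain ⟨q, -, hq, hqc, hqi⟩ := Integrable.exists_hasCompactSupport_integral_sub_le hh
    (by positivity : 0 < ε / 6)
  obtain ⟨p, hp⟩ := exists_polynomial_near_of_continuousOn 0 1 q hqc.continuousOn (ε / 6)
    (by positivity)
  have hpi : IntegrableOn (fun x => p.eval x) (Ioc (0 : ℝ) 1) :=
    (Continuous.integrableOn_Icc (by fun_prop)).mono_set Ioc_subset_Icc_self
  have hd : ∫ x in Ioc (0 : ℝ) 1, |h x - p.eval x| ≤ ε / 3 := by
    have e1 : ∫ x in Ioc (0 : ℝ) 1, |q x - p.eval x| ≤ ε / 6 := by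
      have : ∫ x in Ioc (0 : ℝ) 1, |q x - p.eval x| ≤ ∫ x in Ioc (0 : ℝ) 1, ε / 6 := by
        apply setIntegral_mono_on (hqi.sub hpi).abs (by simp) measurableSet_Ioc
        intro x hx
        rw [Pi.sub_apply, abs_sub_comm]
        exact (hp x ⟨hx.1.le, hx.2⟩).le
      simpa using this
    have e2 : ∫ x in Ioc (0 : ℝ) 1, |h x - p.eval x| ≤
        ∫ x in Ioc (0 : ℝ) 1, (‖h x - q x‖ + |q x - p.eval x|) := by
      apply integral_mono (hh.sub hpi).abs ((hh.sub hqi).norm.add (hqi.sub hpi).abs)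
      intro x
      simp only [Real.norm_eq_abs]
      exact abs_sub_le _ _ _
    have e3 : ∫ x in Ioc (0 : ℝ) 1, (‖h x - q x‖ + |q x - p.eval x|) =
        (∫ x in Ioc (0 : ℝ) 1, ‖h x - q x‖) + ∫ x in Ioc (0 : ℝ) 1, |q x - p.eval x| :=
      integral_add (hh.sub hqi).norm (hqi.sub hpi).abs
    linarith
  obtain ⟨N, hN⟩ := Metric.tendsto_atTop.1 (mix_poly h0 h1 hG hg p hy) (ε / 3) (by positivity)
  refine ⟨N, fun n hn => ?_⟩
  have h3 := hN n hn
  rw [Real.dist_eq, sub_zero] at h3 ⊢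
  have d1 : |(∫ x in EE γ n y, h x) - ∫ x in EE γ n y, p.eval x| ≤ ε / 3 := by
    rw [← integral_sub (hh.mono_set (EE_subI γ n y)) (hpi.mono_set (EE_subI γ n y))]
    refine (abs_integral_le_integral_abs).trans (le_trans ?_ hd)
    exact setIntegral_mono_set (hh.sub hpi).abs (Eventually.of_forall fun x => abs_nonneg _)
      (LE.le.eventuallyLE inter_subset_left)
  have d2 : |(∫ x in Ioc (0 : ℝ) 1, h x) - ∫ x in Ioc (0 : ℝ) 1, p.eval x| ≤ ε / 3 := by
    rw [← integral_sub hh hpi]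
    exact (abs_integral_le_integral_abs).trans hd
  have d3 : |∫ _x in EE γ n y, (1 : ℝ)| ≤ 1 := by
    have i1 : IntegrableOn (fun _ : ℝ => (1 : ℝ)) (Ioc 0 1) := by simp
    rw [abs_of_nonneg (integral_nonneg fun _ => zero_le_one)]
    have : ∫ _x in EE γ n y, (1 : ℝ) ≤ ∫ _x in Ioc (0 : ℝ) 1, (1 : ℝ) :=
      setIntegral_mono_set i1 (Eventually.of_forall fun x => zero_le_one)
        (LE.le.eventuallyLE inter_subset_left)
    simpa using this
  have d4 : |((∫ x in Ioc (0 : ℝ) 1, h x) - ∫ x in Ioc (0 : ℝ) 1, p.eval x) *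
      ∫ _x in EE γ n y, (1 : ℝ)| ≤ ε / 3 := by
    rw [abs_mul]
    nlinarith [abs_nonneg ((∫ x in Ioc (0 : ℝ) 1, h x) - ∫ x in Ioc (0 : ℝ) 1, p.eval x)]
  rw [sub_mul] at d4
  rw [abs_le] at d1 d4
  rw [abs_lt] at h3 ⊢
  constructor <;> linarith

end

section
variable {γ : ℝ} {g V : ℝ → ℝ} {Λ : ℝ} (h0 : 0 < γ) (h1 : γ ≤ 1) (hG : GoodG g V Λ)
  (hg : ∀ y ∈ Icc (0 : ℝ) 1, g y ∈ Icc (0 : ℝ) (1 / 2) ∧ LL γ (g y) = y)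
  (ν : Measure ℝ) [IsProbabilityMeasure ν]
  (hsupp : ν (Set.Icc (0 : ℝ) 1)ᶜ = 0) (hac : ν ≪ volume)
  (hinv : ∀ A : Set ℝ, MeasurableSet A → ν (Tmap γ ⁻¹' A) = ν A)

include hsupp hac in
omit [IsProbabilityMeasure ν] in
lemma nu_compl : ν (Ioc (0 : ℝ) 1)ᶜ = 0 := by
  have h : (Ioc (0 : ℝ) 1)ᶜ ⊆ (Icc (0 : ℝ) 1)ᶜ ∪ {0} := by
    intro x hx
    by_cases h : x = 0
    · right; exact h
    · left; intro h2; exact hx ⟨lt_of_le_of_ne h2.1 (Ne.symm h), h2.2⟩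
  refine measure_mono_null h (measure_union_null hsupp (hac ?_))
  simp

include hinv in
omit [IsProbabilityMeasure ν] in
lemma hinv_iter (n : ℕ) {A : Set ℝ} (hA : MeasurableSet A) : ν ((Tmap γ)^[n] ⁻¹' A) = ν A := by
  induction n with
  | zero => simp
  | succ k ih =>
    rw [Function.iterate_succ, preimage_comp, hinv _ (((Tmap_measurable γ).iterate k) hA), ih]

include h0 h1 hG hg hsupp hac hinv in
lemma nu_lim {y : ℝ} (hy : y ∈ Icc (0 : ℝ) 1) :
    Tendsto (fun n => (Pop g ^ n) id y) atTop (𝓝 (ν.real (Ioc 0 y))) := by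
  have hnull := nu_compl ν hsupp hac
  have hE : ∀ n, ν.real (EE γ n y) = ν.real (Ioc 0 y) := by
    intro n
    unfold Measure.real EE
    rw [inter_comm, measure_inter_conull hnull, hinv_iter ν hinv n measurableSet_Ioc]
  set h : ℝ → ℝ := fun x => (ν.rnDeriv volume x).toReal
  have hh : IntegrableOn h (Ioc 0 1) := Measure.integrable_toReal_rnDeriv.integrableOn
  have hs : ∀ s, ∫ x in s, h x = ν.real s := fun s => Measure.setIntegral_toReal_rnDeriv hac s
  have hm := mix_int h0 h1 hG hg hh hy
  have h01 : ν.real (Ioc (0 : ℝ) 1) = 1 := by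
    have := prob_add_prob_compl (μ := ν) (measurableSet_Ioc (a := (0 : ℝ)) (b := 1))
    rw [hnull, add_zero] at this
    simp [Measure.real, this]
  simp only [hs, hE, h01, one_mul] at hm
  have := (tendsto_const_nhds (x := ν.real (Ioc 0 y))).sub hm
  simp only [sub_sub_cancel, sub_zero] at this
  refine this.congr fun n => ?_
  have i1 : IntegrableOn (fun _ : ℝ => (1 : ℝ)) (Ioc 0 1) := by simp
  rw [Phi_eq h0 h1 hg i1 n hy]
  have key : ∀ n, ∀ z ∈ Icc (0 : ℝ) 1,
      (Pop g ^ n) (fun y => ∫ _x in Ioc 0 y, (1 : ℝ)) z = (Pop g ^ n) id z := by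
    intro n
    induction n with
    | zero => intro z hz; simp [hz.1]
    | succ k ih =>
      intro z hz
      rw [Pop_succ, Pop_succ, Pop_apply, Pop_apply, ih _ (hG.maps' hz), ih _ (r_mem hz),
        ih _ half_mem']
  exact key n y hy

lemma real_Ioc {a b : ℝ} (ha : 0 ≤ a) (hab : a ≤ b) :
    ν.real (Ioc a b) = ν.real (Ioc 0 b) - ν.real (Ioc 0 a) := by
  rw [← measureReal_sdiff (Ioc_subset_Ioc_right hab) measurableSet_Ioc]
  congr 1
  ext x
  simp only [mem_Ioc, Set.mem_sdiff, not_and, not_le]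
  constructor
  · rintro ⟨h, h'⟩; exact ⟨⟨by linarith, h'⟩, fun _ => h⟩
  · rintro ⟨⟨h, h'⟩, h''⟩; exact ⟨h'' h, h'⟩

include h0 h1 hG hg hsupp hac hinv in
lemma nu_facts : ∃ c : ℝ, 0 < c ∧
    (∀ y ∈ Icc (0 : ℝ) 1, ν.real (Ioc 0 y) ≤ V y) ∧
    (∀ a b, 0 ≤ a → a ≤ b → b ≤ 1 → c * (b - a) ≤ ν.real (Ioc a b)) ∧
    (∀ a b, 0 < a → a ≤ b → b ≤ 1 → ν.real (Ioc a b) ≤ V a / a * (b - a)) := by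
  obtain ⟨c, hc0, hc1, hc⟩ := minor hG
  have hid := Dd_id hG
  have hl := fun y hy => nu_lim h0 h1 hG hg ν hsupp hac hinv (y := y) hy
  have hV : ∀ y ∈ Icc (0 : ℝ) 1, ν.real (Ioc 0 y) ≤ V y := fun y hy =>
    le_of_tendsto (hl y hy) (Eventually.of_forall fun n => id_upper hG hid n hy)
  refine ⟨c, hc0, hV, ?_, ?_⟩
  · intro a b ha hab hb
    rw [real_Ioc ν ha hab]
    obtain ⟨N, hN⟩ := hc id hid
    refine ge_of_tendsto ((hl b ⟨ha.trans hab, hb⟩).sub (hl a ⟨ha, hab.trans hb⟩)) ?_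
    filter_upwards [eventually_ge_atTop N] with n hn
    exact hN n hn a b ha hab hb
  · intro a b ha hab hb
    rw [real_Ioc ν ha.le hab]
    have ham : a ∈ Icc (0 : ℝ) 1 := ⟨ha.le, hab.trans hb⟩
    refine le_of_tendsto ((hl b ⟨ha.le.trans hab, hb⟩).sub (hl a ham)) ?_
    filter_upwards with n
    have hDn := hid.pops hG n
    have := conc_incr hDn.conc hDn.zero ha hab hb
    refine this.trans ?_
    have := id_upper hG hid n ham
    have : 0 ≤ b - a := by linarith
    gcongr
end

section
variable {A c : ℝ} (ν : Measure ℝ) [IsProbabilityMeasure ν] (hac : ν ≪ volume)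
  (hA : 0 < A) (hc : 0 < c)
  (hlow : ∀ a b, 0 ≤ a → a ≤ b → b ≤ 1 → c * (b - a) ≤ ν.real (Ioc a b))
  (hup : ∀ a b, 0 < a → a ≤ b → b ≤ 1 →
    ν.real (Ioc a b) ≤ A * a ^ (3 / 4 : ℝ) / a * (b - a))

include hac hA hlow hup in
lemma dens_bound : ∀ᵐ x ∂(volume.restrict (Ioc (0 : ℝ) 1)),
    ENNReal.ofReal c ≤ ν.rnDeriv volume x ∧
      ν.rnDeriv volume x ≤ ENNReal.ofReal (2 * A * x ^ (-(1 / 4) : ℝ)) := by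
  rw [← Measure.restrict_congr_set Ioo_ae_eq_Ioc, ae_restrict_iff' measurableSet_Ioo]
  filter_upwards [Besicovitch.ae_tendsto_rnDeriv ν volume] with x hx hx01
  have hb : ∀ᶠ r in 𝓝[>] (0 : ℝ),
      ENNReal.ofReal c ≤ ν (Metric.closedBall x r) / volume (Metric.closedBall x r) ∧
      ν (Metric.closedBall x r) / volume (Metric.closedBall x r) ≤
        ENNReal.ofReal (2 * A * x ^ (-(1 / 4) : ℝ)) := by
    have hr0 : 0 < min (x / 2) (1 - x) := lt_min (by linarith [hx01.1]) (by linarith [hx01.2])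
    filter_upwards [Ioo_mem_nhdsGT hr0] with r hr
    have hr1 := hr.2.trans_le (min_le_left _ _)
    have hr2 := hr.2.trans_le (min_le_right _ _)
    have hrp := hr.1
    have hx0 := hx01.1
    have e1 : ν (Metric.closedBall x r) = ENNReal.ofReal (ν.real (Ioc (x - r) (x + r))) := by
      rw [Real.closedBall_eq_Icc, ofReal_measureReal]
      refine (measure_congr (hac.ae_eq Ioc_ae_eq_Icc)).symm
    have e2 : volume (Metric.closedBall x r) = ENNReal.ofReal (2 * r) := Real.volume_closedBall x r
    rw [e1, e2, ← ENNReal.ofReal_div_of_pos (by linarith)]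
    have l1 := hlow (x - r) (x + r) (by linarith) (by linarith) (by linarith)
    have l2 := hup (x - r) (x + r) (by linarith) (by linarith) (by linarith)
    have e3 : x + r - (x - r) = 2 * r := by ring
    rw [e3] at l1 l2
    constructor
    · apply ENNReal.ofReal_le_ofReal
      rw [le_div_iff₀ (by linarith)]; exact l1
    · apply ENNReal.ofReal_le_ofReal
      rw [div_le_iff₀ (by linarith)]
      refine l2.trans ?_
      have hp : 0 < x - r := by linarith
      have e4 : A * (x - r) ^ (3 / 4 : ℝ) / (x - r) = A * (x - r) ^ (-(1 / 4) : ℝ) := by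
        rw [mul_div_assoc, ← Real.rpow_sub_one hp.ne']; norm_num
      rw [e4]
      have e5 : (x - r) ^ (-(1 / 4) : ℝ) ≤ (x / 2) ^ (-(1 / 4) : ℝ) :=
        Real.rpow_le_rpow_of_nonpos (by linarith) (by linarith) (by norm_num)
      have e6 : (x / 2) ^ (-(1 / 4) : ℝ) ≤ 2 * x ^ (-(1 / 4) : ℝ) := by
        rw [Real.div_rpow hx0.le (by norm_num), Real.rpow_neg (by norm_num : (0 : ℝ) ≤ 2),
          div_inv_eq_mul, mul_comm]
        have : (2 : ℝ) ^ (1 / 4 : ℝ) ≤ 2 ^ (1 : ℝ) :=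
          Real.rpow_le_rpow_of_exponent_le (by norm_num) (by norm_num)
        rw [Real.rpow_one] at this
        gcongr
      have e7 := e5.trans e6
      have : A * (x - r) ^ (-(1 / 4) : ℝ) ≤ A * (2 * x ^ (-(1 / 4) : ℝ)) := by gcongr
      nlinarith
  exact ⟨ge_of_tendsto hx (hb.mono fun _ h => h.1), le_of_tendsto hx (hb.mono fun _ h => h.2)⟩

include hac hA hlow hup in
lemma dens_low {F : ℝ → ENNReal} (hF : Measurable F) :
    ENNReal.ofReal c * ∫⁻ x in Ioc (0 : ℝ) 1, F x ≤ ∫⁻ x, F x ∂ν := by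
  rw [← lintegral_rnDeriv_mul hac hF.aemeasurable, ← lintegral_const_mul _ hF]
  refine le_trans ?_ (setLIntegral_le_lintegral (Ioc (0 : ℝ) 1) _)
  apply lintegral_mono_ae
  filter_upwards [dens_bound ν hac hA hlow hup] with x hx
  gcongr
  exact hx.1

include hac hA hlow hup in
lemma dens_up (hnull : ν (Ioc (0 : ℝ) 1)ᶜ = 0) {F : ℝ → ENNReal} (hF : Measurable F) :
    ∫⁻ x, F x ∂ν ≤ ∫⁻ x in Ioc (0 : ℝ) 1, F x * ENNReal.ofReal (2 * A * x ^ (-(1 / 4) : ℝ)) := by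
  have h1 : ∫⁻ x, F x ∂ν = ∫⁻ x in Ioc (0 : ℝ) 1, F x ∂ν := by
    rw [← lintegral_add_compl F (measurableSet_Ioc (a := (0 : ℝ)) (b := 1)),
      Measure.restrict_eq_zero.2 hnull]
    simp
  rw [h1, ← setLIntegral_rnDeriv_mul hac hF.aemeasurable measurableSet_Ioc]
  apply lintegral_mono_ae
  filter_upwards [dens_bound ν hac hA hlow hup] with x hx
  rw [mul_comm]
  gcongr
  exact hx.2

end

lemma cov_left {γ : ℝ} (h0 : 0 < γ) (h1 : γ ≤ 1) (Ψ : ℝ → ENNReal) :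
    ∫⁻ x in Ioc (0 : ℝ) (1 / 2), ENNReal.ofReal (LD γ x) * Ψ (LL γ x) ≤
      ∫⁻ x in Ioc (0 : ℝ) 1, Ψ x := by
  have hsub : Ioc (0 : ℝ) (1 / 2) ⊆ Icc 0 (1 / 2) := Ioc_subset_Icc_self
  have := lintegral_image_eq_lintegral_abs_deriv_mul (measurableSet_Ioc (a := (0 : ℝ)) (b := 1 / 2))
    (f := LL γ) (f' := LD γ)
    (fun x hx => (LL_hasDerivAt γ hx.1 (by linarith [hx.2])).hasDerivWithinAt)
    ((LL_strictMono h0 h1).injOn.mono hsub) Ψ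
  have e : ∫⁻ x in Ioc (0 : ℝ) (1 / 2), ENNReal.ofReal (LD γ x) * Ψ (LL γ x) =
      ∫⁻ x in Ioc (0 : ℝ) (1 / 2), ENNReal.ofReal |LD γ x| * Ψ (LL γ x) := by
    apply setLIntegral_congr_fun measurableSet_Ioc
    intro x hx
    simp only
    rw [abs_of_nonneg]
    have := LD_ge h0 h1 hx.1 hx.2
    have := vv_pos γ hx.1 hx.2
    linarith
  rw [e, ← this]
  apply lintegral_mono_set
  rintro _ ⟨x, hx, rfl⟩
  have := LL_le h0 h1 hx.1.le hx.2
  exact ⟨by linarith [hx.1], by linarith [hx.2]⟩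

lemma cov_right (Ψ : ℝ → ENNReal) :
    ∫⁻ x in Ioc (1 / 2 : ℝ) 1, ENNReal.ofReal 2 * Ψ (2 * x - 1) ≤
      ∫⁻ x in Ioc (0 : ℝ) 1, Ψ x := by
  have := lintegral_image_eq_lintegral_abs_deriv_mul (measurableSet_Ioc (a := (1 / 2 : ℝ)) (b := 1))
    (f := fun x => 2 * x - 1) (f' := fun _ => 2)
    (fun x hx => by
      simpa using (((hasDerivAt_id x).const_mul 2).sub_const 1).hasDerivWithinAt)
    (fun x _ y _ h => by simpa using h) Ψ
  rw [abs_of_nonneg (by norm_num)] at this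
  rw [← this]
  apply lintegral_mono_set
  rintro _ ⟨x, hx, rfl⟩
  simp only
  exact ⟨by linarith [hx.1], by linarith [hx.2]⟩

/-- pointwise inequality -/
lemma point_ineq {γ : ℝ} (h0 : 0 < γ) (h1 : γ ≤ 1) {x η lam A W I : ℝ} (hx : 0 < x)
    (hx2 : x ≤ 1 / 2) (hη : 0 < η) (hA : 0 < A)
    (hcase : (W = 1 ∧ I = 0) ∨
      (W ≤ Real.exp lam ∧ I = 1 ∧ 0 ≤ lam ∧ lam ≤ vv γ x / 12 ∧
        4 * A * x ^ (1 / 4 : ℝ) ≤ η * vv γ x / 6)) :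
    η * W * x ^ (-(1 / 2) : ℝ) + 2 * I * (2 * A * x ^ (-(1 / 4) : ℝ)) ≤
      LD γ x * (η * (LL γ x) ^ (-(1 / 2) : ℝ)) := by
  have hv := vv_pos γ hx hx2
  have hv1 := vv_le_one h0 h1 hx hx2
  have hs := sqrt_ge hv.le hv1
  have hD := LD_ge h0 h1 hx hx2
  set v := vv γ x
  have hxp : 0 < x ^ (-(1 / 2) : ℝ) := by positivity
  have e1 : (LL γ x) ^ (-(1 / 2) : ℝ) = x ^ (-(1 / 2) : ℝ) * (1 + v) ^ (-(1 / 2) : ℝ) := by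
    rw [LL, Real.mul_rpow hx.le (by linarith)]
  have e2 : (1 + v) * (1 + v) ^ (-(1 / 2) : ℝ) = (1 + v) ^ (1 / 2 : ℝ) := by
    nth_rw 1 [← Real.rpow_one (1 + v)]
    rw [← Real.rpow_add (by linarith)]; norm_num
  have e3 : η * x ^ (-(1 / 2) : ℝ) * (1 + v / 3) ≤ LD γ x * (η * (LL γ x) ^ (-(1 / 2) : ℝ)) := by
    rw [e1]
    calc η * x ^ (-(1 / 2) : ℝ) * (1 + v / 3)
        ≤ η * x ^ (-(1 / 2) : ℝ) * ((1 + v) * (1 + v) ^ (-(1 / 2) : ℝ)) := by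
          rw [e2]; gcongr
      _ = (1 + v) * (η * (x ^ (-(1 / 2) : ℝ) * (1 + v) ^ (-(1 / 2) : ℝ))) := by ring
      _ ≤ _ := by gcongr
  refine le_trans ?_ e3
  rcases hcase with ⟨rfl, rfl⟩ | ⟨hW, rfl, hl0, hl1, hAx⟩
  · have : 0 < η * x ^ (-(1 / 2) : ℝ) := by positivity
    nlinarith
  · have hexp : Real.exp lam ≤ 1 + 2 * lam := by
      have := Real.abs_exp_sub_one_le (x := lam) (by rw [abs_of_nonneg hl0]; linarith)
      rw [abs_of_nonneg hl0] at this
      linarith [le_abs_self (Real.exp lam - 1)]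
    have hW2 : W ≤ 1 + v / 6 := by linarith
    have e4 : x ^ (-(1 / 4) : ℝ) = x ^ (-(1 / 2) : ℝ) * x ^ (1 / 4 : ℝ) := by
      rw [← Real.rpow_add hx]; norm_num
    rw [e4]
    have t1 : η * W * x ^ (-(1 / 2) : ℝ) ≤ η * (1 + v / 6) * x ^ (-(1 / 2) : ℝ) := by gcongr
    have t2 : x ^ (-(1 / 2) : ℝ) * (4 * A * x ^ (1 / 4 : ℝ)) ≤ x ^ (-(1 / 2) : ℝ) * (η * v / 6) := by
      gcongr
    nlinarith

open Classical in
noncomputable def ww (θ δ lam x : ℝ) : ENNReal :=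
  if x ∈ Ioc θ δ then ENNReal.ofReal (Real.exp lam) else 1

open Classical in
noncomputable def ii (θ δ x : ℝ) : ENNReal := if x ∈ Ioc θ δ then 1 else 0

lemma ww_meas (θ δ lam : ℝ) : Measurable (ww θ δ lam) :=
  Measurable.ite measurableSet_Ioc measurable_const measurable_const

lemma ii_meas (θ δ : ℝ) : Measurable (ii θ δ) :=
  Measurable.ite measurableSet_Ioc measurable_const measurable_const

lemma exp_le_two {lam : ℝ} (h0 : 0 ≤ lam) (h1 : lam ≤ 1) : Real.exp lam ≤ 1 + 2 * lam := by
  have := Real.abs_exp_sub_one_le (x := lam) (by rw [abs_of_nonneg h0]; exact h1)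
  rw [abs_of_nonneg h0] at this
  linarith [le_abs_self (Real.exp lam - 1)]

lemma ww_le {θ δ lam : ℝ} (h0 : 0 ≤ lam) (h1 : lam ≤ 1) (x : ℝ) :
    ww θ δ lam x ≤ 1 + ENNReal.ofReal (2 * lam) * ii θ δ x := by
  unfold ww ii
  split_ifs
  · rw [mul_one, ← ENNReal.ofReal_one, ← ENNReal.ofReal_add (by norm_num) (by linarith)]
    exact ENNReal.ofReal_le_ofReal (exp_le_two h0 h1)
  · simp

noncomputable def JJ (ν : Measure ℝ) (b : ℝ) (ψ : ℝ → ENNReal) : ENNReal :=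
  ∫⁻ x, ψ x ∂ν + ENNReal.ofReal b * ∫⁻ x in Ioc (0 : ℝ) 1, ψ x * ENNReal.ofReal (x ^ (-(1 / 2) : ℝ))

noncomputable def HH (θ δ lam η A x : ℝ) : ENNReal :=
  ENNReal.ofReal η * ww θ δ lam x * ENNReal.ofReal (x ^ (-(1 / 2) : ℝ)) +
    ENNReal.ofReal 2 * ii θ δ x * ENNReal.ofReal (2 * A * x ^ (-(1 / 4) : ℝ))

lemma HH_left {γ : ℝ} (h0 : 0 < γ) (h1 : γ ≤ 1) {θ δ lam η A x : ℝ} (hx : 0 < x)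
    (hx2 : x ≤ 1 / 2) (hη : 0 < η) (hA : 0 < A) (hl : 0 ≤ lam)
    (hcond : x ∈ Ioc θ δ → lam ≤ vv γ x / 12 ∧ 4 * A * x ^ (1 / 4 : ℝ) ≤ η * vv γ x / 6) :
    HH θ δ lam η A x ≤ ENNReal.ofReal (LD γ x) *
      (ENNReal.ofReal η * ENNReal.ofReal ((LL γ x) ^ (-(1 / 2) : ℝ))) := by
  have hLD : 0 ≤ LD γ x := by
    have := LD_ge h0 h1 hx hx2
    have := vv_pos γ hx hx2
    linarith
  rw [← ENNReal.ofReal_mul hη.le, ← ENNReal.ofReal_mul hLD]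
  unfold HH ww ii
  split_ifs with h
  · rw [← ENNReal.ofReal_mul hη.le, ← ENNReal.ofReal_mul (by positivity), mul_one,
      ← ENNReal.ofReal_mul (by norm_num), ← ENNReal.ofReal_add (by positivity) (by positivity)]
    apply ENNReal.ofReal_le_ofReal
    have := point_ineq h0 h1 hx hx2 hη hA (W := Real.exp lam) (I := 1) (lam := lam)
      (Or.inr ⟨le_rfl, rfl, hl, hcond h⟩)
    simpa using this
  · rw [mul_one, mul_zero, zero_mul, add_zero, ← ENNReal.ofReal_mul hη.le]
    apply ENNReal.ofReal_le_ofReal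
    have := point_ineq h0 h1 hx hx2 hη hA (W := 1) (I := 0) (lam := lam) (Or.inl ⟨rfl, rfl⟩)
    simpa using this

lemma HH_right {θ δ lam η A x : ℝ} (hδ : δ ≤ 1 / 2) (hx : 1 / 2 < x) :
    HH θ δ lam η A x ≤ ENNReal.ofReal 2 * ENNReal.ofReal η := by
  have hn : x ∉ Ioc θ δ := fun h => by linarith [h.2]
  unfold HH ww ii
  rw [if_neg hn, if_neg hn, mul_one, mul_zero, zero_mul, add_zero, mul_comm]
  gcongr
  have h1 : x ^ (-(1 / 2) : ℝ) ≤ (1 / 2 : ℝ) ^ (-(1 / 2) : ℝ) :=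
    Real.rpow_le_rpow_of_nonpos (by norm_num) hx.le (by norm_num)
  have h2 : (1 / 2 : ℝ) ^ (-(1 / 2) : ℝ) ≤ (1 / 2 : ℝ) ^ (-1 : ℝ) :=
    Real.rpow_le_rpow_of_exponent_ge (by norm_num) (by norm_num) (by norm_num)
  have h3 : (1 / 2 : ℝ) ^ (-1 : ℝ) = 2 := by rw [Real.rpow_neg_one]; norm_num
  linarith

lemma one_step {γ : ℝ} (h0 : 0 < γ) (h1 : γ ≤ 1) {A c : ℝ} (ν : Measure ℝ)
    [IsProbabilityMeasure ν] (hac : ν ≪ volume) (hA : 0 < A) (hc : 0 < c)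
    (hlow : ∀ a b, 0 ≤ a → a ≤ b → b ≤ 1 → c * (b - a) ≤ ν.real (Ioc a b))
    (hup : ∀ a b, 0 < a → a ≤ b → b ≤ 1 →
      ν.real (Ioc a b) ≤ A * a ^ (3 / 4 : ℝ) / a * (b - a))
    (hnull : ν (Ioc (0 : ℝ) 1)ᶜ = 0)
    (hinv : ∀ A : Set ℝ, MeasurableSet A → ν (Tmap γ ⁻¹' A) = ν A)
    {θ δ lam : ℝ} (hδ : δ ≤ 1 / 2) (hl : 0 ≤ lam) (hl1 : lam ≤ 1)
    (hcond : ∀ x, 0 < x → x ∈ Ioc θ δ →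
      lam ≤ vv γ x / 12 ∧ 4 * A * x ^ (1 / 4 : ℝ) ≤ c / 4 * vv γ x / 6)
    {ψ : ℝ → ENNReal} (hψ : Measurable ψ) :
    JJ ν (lam * (c / 4)) (fun x => ww θ δ lam x * ψ (Tmap γ x)) ≤
      ENNReal.ofReal (1 + lam / 4) * JJ ν (lam * (c / 4)) ψ := by
  have hT := Tmap_measurable γ
  have hψT : Measurable fun x => ψ (Tmap γ x) := hψ.comp hT
  have hw := ww_meas θ δ lam
  have hi := ii_meas θ δ
  have hiψ : Measurable fun x => ii θ δ x * ψ (Tmap γ x) := hi.mul hψT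
  have hη : 0 < c / 4 := by linarith
  have hmeasH : Measurable (HH θ δ lam (c / 4) A) := by
    unfold HH; fun_prop
  have hmap : ∫⁻ x, ψ (Tmap γ x) ∂ν = ∫⁻ x, ψ x ∂ν := by
    rw [← lintegral_map hψ hT]
    congr 1
    ext s hs
    rw [Measure.map_apply hT hs, hinv s hs]
  -- first part
  have s1 : ∫⁻ x, ww θ δ lam x * ψ (Tmap γ x) ∂ν ≤ ∫⁻ x, ψ x ∂ν + ENNReal.ofReal (2 * lam) *
      ∫⁻ x in Ioc (0 : ℝ) 1, ii θ δ x * ψ (Tmap γ x) *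
        ENNReal.ofReal (2 * A * x ^ (-(1 / 4) : ℝ)) := by
    calc _ ≤ ∫⁻ x, (ψ (Tmap γ x) + ENNReal.ofReal (2 * lam) * (ii θ δ x * ψ (Tmap γ x))) ∂ν := by
          apply lintegral_mono
          intro x
          calc ww θ δ lam x * ψ (Tmap γ x)
              ≤ (1 + ENNReal.ofReal (2 * lam) * ii θ δ x) * ψ (Tmap γ x) := by
                gcongr; exact ww_le hl hl1 x
            _ = _ := by ring
      _ = ∫⁻ x, ψ x ∂ν + ENNReal.ofReal (2 * lam) * ∫⁻ x, ii θ δ x * ψ (Tmap γ x) ∂ν := by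
          rw [lintegral_add_left hψT, hmap, lintegral_const_mul _ hiψ]
      _ ≤ _ := by
          exact add_le_add_right (mul_le_mul_right (dens_up ν hac hA hlow hup hnull hiψ) _) _
  have s2 : JJ ν (lam * (c / 4)) (fun x => ww θ δ lam x * ψ (Tmap γ x)) ≤
      ∫⁻ x, ψ x ∂ν + ENNReal.ofReal lam *
        ∫⁻ x in Ioc (0 : ℝ) 1, ψ (Tmap γ x) * HH θ δ lam (c / 4) A x := by
    unfold JJ
    refine (add_le_add_left s1 _).trans (le_of_eq ?_)
    rw [add_assoc]
    congr 1
    have e : ∀ x, ψ (Tmap γ x) * HH θ δ lam (c / 4) A x =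
        ENNReal.ofReal 2 * (ii θ δ x * ψ (Tmap γ x) *
          ENNReal.ofReal (2 * A * x ^ (-(1 / 4) : ℝ))) +
        ENNReal.ofReal (c / 4) * (ww θ δ lam x * ψ (Tmap γ x) *
          ENNReal.ofReal (x ^ (-(1 / 2) : ℝ))) := by
      intro x; unfold HH; ring
    simp_rw [e]
    rw [lintegral_add_left (by fun_prop), lintegral_const_mul _ (by fun_prop),
      lintegral_const_mul _ (by fun_prop), mul_add, ← mul_assoc, ← mul_assoc,
      ← ENNReal.ofReal_mul hl, ← ENNReal.ofReal_mul hl, mul_comm lam 2]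
  have hsplit : ∫⁻ x in Ioc (0 : ℝ) 1, ψ (Tmap γ x) * HH θ δ lam (c / 4) A x =
      (∫⁻ x in Ioc (0 : ℝ) (1 / 2), ψ (Tmap γ x) * HH θ δ lam (c / 4) A x) +
      ∫⁻ x in Ioc (1 / 2 : ℝ) 1, ψ (Tmap γ x) * HH θ δ lam (c / 4) A x := by
    rw [← Ioc_union_Ioc_eq_Ioc (by norm_num : (0 : ℝ) ≤ 1 / 2) (by norm_num : (1 / 2 : ℝ) ≤ 1)]
    apply lintegral_union measurableSet_Ioc
    exact Set.Ioc_disjoint_Ioc_of_le le_rfl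
  have hL : ∫⁻ x in Ioc (0 : ℝ) (1 / 2), ψ (Tmap γ x) * HH θ δ lam (c / 4) A x ≤
      ENNReal.ofReal (c / 4) * ∫⁻ x in Ioc (0 : ℝ) 1, ψ x * ENNReal.ofReal (x ^ (-(1 / 2) : ℝ)) := by
    rw [← lintegral_const_mul _ (by fun_prop)]
    refine le_trans ?_ (cov_left h0 h1 _)
    apply setLIntegral_mono' measurableSet_Ioc
    intro x hx
    rw [Tmap_eq_LL γ hx.1.le hx.2]
    calc _ ≤ ψ (LL γ x) * (ENNReal.ofReal (LD γ x) *
          (ENNReal.ofReal (c / 4) * ENNReal.ofReal ((LL γ x) ^ (-(1 / 2) : ℝ)))) := by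
          gcongr
          exact HH_left h0 h1 hx.1 hx.2 hη hA hl (hcond x hx.1)
      _ = _ := by ring
  have hR : ∫⁻ x in Ioc (1 / 2 : ℝ) 1, ψ (Tmap γ x) * HH θ δ lam (c / 4) A x ≤
      ENNReal.ofReal (1 / 4) * ∫⁻ x, ψ x ∂ν := by
    have a1 : ∫⁻ x in Ioc (1 / 2 : ℝ) 1, ψ (Tmap γ x) * HH θ δ lam (c / 4) A x ≤
        ∫⁻ x in Ioc (0 : ℝ) 1, ENNReal.ofReal (c / 4) * ψ x := by
      refine le_trans ?_ (cov_right _)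
      apply setLIntegral_mono' measurableSet_Ioc
      intro x hx
      rw [Tmap_right γ hx.1]
      calc _ ≤ ψ (2 * x - 1) * (ENNReal.ofReal 2 * ENNReal.ofReal (c / 4)) := by
            gcongr
            exact HH_right hδ hx.1
        _ = _ := by ring
    refine a1.trans ?_
    rw [lintegral_const_mul _ hψ, show c / 4 = 1 / 4 * c by ring,
      ENNReal.ofReal_mul (by norm_num), mul_assoc]
    gcongr
    exact dens_low ν hac hA hlow hup hψ
  refine s2.trans ?_
  rw [hsplit]
  unfold JJ
  set P := ∫⁻ x, ψ x ∂ν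
  set Q := ∫⁻ x in Ioc (0 : ℝ) 1, ψ x * ENNReal.ofReal (x ^ (-(1 / 2) : ℝ))
  calc _ ≤ P + ENNReal.ofReal lam * (ENNReal.ofReal (c / 4) * Q + ENNReal.ofReal (1 / 4) * P) := by
        gcongr
    _ = ENNReal.ofReal (1 + lam / 4) * P + ENNReal.ofReal (lam * (c / 4)) * Q := by
        rw [ENNReal.ofReal_add (by norm_num) (by linarith), ENNReal.ofReal_one,
          show lam / 4 = lam * (1 / 4) by ring, ENNReal.ofReal_mul hl, ENNReal.ofReal_mul hl]
        ring
    _ ≤ ENNReal.ofReal (1 + lam / 4) * P +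
        ENNReal.ofReal (1 + lam / 4) * (ENNReal.ofReal (lam * (c / 4)) * Q) := by
        refine add_le_add_right (le_mul_of_one_le_left zero_le ?_) _
        rw [← ENNReal.ofReal_one]
        exact ENNReal.ofReal_le_ofReal (by linarith)
    _ = _ := by ring

noncomputable def PP (γ θ δ lam : ℝ) (n : ℕ) (x : ℝ) : ENNReal :=
  ∏ k ∈ Finset.range n, ww θ δ lam ((Tmap γ)^[k] x)

lemma PP_meas (γ θ δ lam : ℝ) (n : ℕ) : Measurable (PP γ θ δ lam n) := by
  unfold PP
  exact Finset.measurable_prod _ fun k _ => (ww_meas θ δ lam).comp ((Tmap_measurable γ).iterate k)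

lemma PP_succ (γ θ δ lam : ℝ) (n : ℕ) :
    PP γ θ δ lam (n + 1) = fun x => ww θ δ lam x * PP γ θ δ lam n (Tmap γ x) := by
  funext x
  unfold PP
  rw [Finset.prod_range_succ']
  simp [mul_comm]

lemma int_half : ∫⁻ x in Ioc (0 : ℝ) 1, ENNReal.ofReal (x ^ (-(1 / 2) : ℝ)) = ENNReal.ofReal 2 := by
  have hi : IntervalIntegrable (fun x : ℝ => x ^ (-(1 / 2) : ℝ)) volume 0 1 :=
    intervalIntegral.intervalIntegrable_rpow' (by norm_num)
  have hi' : IntegrableOn (fun x : ℝ => x ^ (-(1 / 2) : ℝ)) (Ioc 0 1) :=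
    (intervalIntegrable_iff_integrableOn_Ioc_of_le (by norm_num)).1 hi
  rw [← ofReal_integral_eq_lintegral_ofReal hi']
  · rw [← intervalIntegral.integral_of_le (by norm_num), integral_rpow (Or.inl (by norm_num))]
    norm_num
  · exact (ae_restrict_mem measurableSet_Ioc).mono fun x hx => Real.rpow_nonneg hx.1.le _

lemma PP_bound {γ : ℝ} (h0 : 0 < γ) (h1 : γ ≤ 1) {A c : ℝ} (ν : Measure ℝ)
    [IsProbabilityMeasure ν] (hac : ν ≪ volume) (hA : 0 < A) (hc : 0 < c)
    (hlow : ∀ a b, 0 ≤ a → a ≤ b → b ≤ 1 → c * (b - a) ≤ ν.real (Ioc a b))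
    (hup : ∀ a b, 0 < a → a ≤ b → b ≤ 1 →
      ν.real (Ioc a b) ≤ A * a ^ (3 / 4 : ℝ) / a * (b - a))
    (hnull : ν (Ioc (0 : ℝ) 1)ᶜ = 0)
    (hinv : ∀ A : Set ℝ, MeasurableSet A → ν (Tmap γ ⁻¹' A) = ν A)
    {θ δ lam : ℝ} (hδ : δ ≤ 1 / 2) (hl : 0 ≤ lam) (hl1 : lam ≤ 1)
    (hcond : ∀ x, 0 < x → x ∈ Ioc θ δ →
      lam ≤ vv γ x / 12 ∧ 4 * A * x ^ (1 / 4 : ℝ) ≤ c / 4 * vv γ x / 6) (n : ℕ) :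
    ∫⁻ x, PP γ θ δ lam n x ∂ν ≤ ENNReal.ofReal ((1 + c) * Real.exp (lam * n / 4)) := by
  have key : JJ ν (lam * (c / 4)) (PP γ θ δ lam n) ≤
      ENNReal.ofReal ((1 + c) * Real.exp (lam * n / 4)) := by
    induction n with
    | zero =>
      have e : PP γ θ δ lam 0 = fun _ => 1 := by funext x; simp [PP]
      rw [e]
      unfold JJ
      simp only [one_mul, int_half]
      rw [lintegral_one, measure_univ, ← ENNReal.ofReal_mul (by positivity), ← ENNReal.ofReal_one,
        ← ENNReal.ofReal_add (by norm_num) (by positivity)]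
      apply ENNReal.ofReal_le_ofReal
      simp
      nlinarith
    | succ n ih =>
      rw [PP_succ]
      refine (one_step h0 h1 ν hac hA hc hlow hup hnull hinv hδ hl hl1 hcond
        (PP_meas γ θ δ lam n)).trans ?_
      refine (mul_le_mul_right ih _).trans ?_
      rw [← ENNReal.ofReal_mul (by linarith)]
      apply ENNReal.ofReal_le_ofReal
      have : Real.exp (lam * ((n + 1 : ℕ) : ℝ) / 4) =
          Real.exp (lam / 4) * Real.exp (lam * n / 4) := by
        rw [← Real.exp_add]; congr 1; push_cast; ring
      rw [this]
      have h2 := Real.add_one_le_exp (lam / 4)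
      calc (1 + lam / 4) * ((1 + c) * Real.exp (lam * n / 4))
          ≤ Real.exp (lam / 4) * ((1 + c) * Real.exp (lam * n / 4)) := by
            gcongr; linarith
        _ = _ := by ring
  exact le_trans (by unfold JJ; exact le_self_add) key

lemma cb_pos (γ : ℝ) : 0 < (Real.log 2) ^ (1 / γ - 1) := Real.rpow_pos_of_pos log2_pos _

lemma cb_le {γ : ℝ} (h0 : 0 < γ) (h1 : γ ≤ 1) : (Real.log 2) ^ (1 / γ - 1) ≤ 1 :=
  Real.rpow_le_one log2_pos.le (by linarith [Real.log_two_lt_d9]) (beta_nonneg h0 h1)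

lemma sB_eq {γ : ℝ} (h0 : 0 < γ) {n : ℕ} (hn : 1 ≤ n) :
    (n : ℝ) ^ γ * ((n : ℝ) ^ γ) ^ (1 / γ - 1) = n := by
  have hn' : (0 : ℝ) < n := by exact_mod_cast hn
  rw [← Real.rpow_mul hn'.le, ← Real.rpow_add hn']
  have : γ + γ * (1 / γ - 1) = 1 := by field_simp; ring
  rw [this, Real.rpow_one]

lemma vv_lower {γ : ℝ} (h0 : 0 < γ) (h1 : γ ≤ 1) {x s : ℝ} (hx : 0 < x) (hx2 : x ≤ 1 / 2)
    (hs : Real.exp (-s) < x) : (Real.log 2) ^ (1 / γ - 1) / s ^ (1 / γ - 1) ≤ vv γ x := by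
  have h2 := abslog_ge hx hx2
  have h3 := log2_pos
  have h4 : -s < Real.log x := (Real.lt_log_iff_exp_lt hx).2 hs
  have h5 : |Real.log x| ≤ s := by
    rw [abs_of_nonpos (Real.log_nonpos hx.le (by linarith))]; linarith
  unfold vv
  have hp : 0 < |Real.log x| := by linarith
  apply div_le_div_of_nonneg_left (cb_pos γ).le (Real.rpow_pos_of_pos hp _)
  exact Real.rpow_le_rpow hp.le h5 (beta_nonneg h0 h1)

lemma vv_upper {γ : ℝ} (h0 : 0 < γ) (h1 : γ ≤ 1) {x s : ℝ} (hs0 : 0 < s)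
    (hs : s ≤ -Real.log x) : vv γ x ≤ (Real.log 2) ^ (1 / γ - 1) / s ^ (1 / γ - 1) := by
  unfold vv
  apply div_le_div_of_nonneg_left (cb_pos γ).le (Real.rpow_pos_of_pos hs0 _)
  exact Real.rpow_le_rpow hs0.le (hs.trans (neg_le_abs _)) (beta_nonneg h0 h1)

lemma g_facts {γ : ℝ} (h0 : 0 < γ) (h1 : γ ≤ 1) {g : ℝ → ℝ}
    (hg : ∀ y ∈ Icc (0 : ℝ) 1, g y ∈ Icc (0 : ℝ) (1 / 2) ∧ LL γ (g y) = y) {y : ℝ}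
    (hy : 0 < y) (hy1 : y ≤ 1) : 0 < g y ∧ g y ≤ y := by
  obtain ⟨h, e⟩ := hg y ⟨hy.le, hy1⟩
  have := LL_le h0 h1 h.1 h.2
  rw [e] at this
  exact ⟨by linarith, this.1⟩

lemma g_lower {γ : ℝ} (h0 : 0 < γ) (h1 : γ ≤ 1) {g : ℝ → ℝ}
    (hg : ∀ y ∈ Icc (0 : ℝ) 1, g y ∈ Icc (0 : ℝ) (1 / 2) ∧ LL γ (g y) = y) {d s : ℝ}
    (hd : 0 < d) (hd1 : d ≤ 1) (hs : 0 < s) (k : ℕ) :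
    0 < g^[k] d ∧ g^[k] d ≤ d ∧
      Real.log d - s - k * ((Real.log 2) ^ (1 / γ - 1) / s ^ (1 / γ - 1)) ≤
        Real.log (g^[k] d) := by
  have hε : 0 ≤ (Real.log 2) ^ (1 / γ - 1) / s ^ (1 / γ - 1) :=
    div_nonneg (cb_pos γ).le (Real.rpow_nonneg hs.le _)
  induction k with
  | zero => simp [hd, hs.le]
  | succ k ih =>
    obtain ⟨i1, i2, i3⟩ := ih
    rw [Function.iterate_succ_apply']
    set y := g^[k] d
    set ε := (Real.log 2) ^ (1 / γ - 1) / s ^ (1 / γ - 1) with hεd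
    obtain ⟨p1, p2⟩ := g_facts h0 h1 hg i1 (i2.trans hd1)
    obtain ⟨q1, q2⟩ := hg y ⟨i1.le, i2.trans hd1⟩
    refine ⟨p1, p2.trans i2, ?_⟩
    push_cast
    rcases le_total s (-Real.log (g y)) with h | h
    · have hv := vv_upper h0 h1 hs h
      have hvp := vv_pos γ p1 q1.2
      have e : Real.log y = Real.log (g y) + Real.log (1 + vv γ (g y)) := by
        conv_lhs => rw [← q2]
        unfold LL
        rw [Real.log_mul p1.ne' (by linarith)]
      have := Real.log_le_sub_one_of_pos (show 0 < 1 + vv γ (g y) by linarith)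
      rw [← hεd] at hv
      linarith
    · have := Real.log_nonpos hd.le hd1
      have hk : (0 : ℝ) ≤ k := k.cast_nonneg
      nlinarith

lemma orbit_small {γ : ℝ} (h0 : 0 < γ) (h1 : γ ≤ 1) {g : ℝ → ℝ}
    (hg : ∀ y ∈ Icc (0 : ℝ) 1, g y ∈ Icc (0 : ℝ) (1 / 2) ∧ LL γ (g y) = y) {d : ℝ}
    (hd : 0 < d) (hd1 : d ≤ 1) (n : ℕ) :
    ∀ x, 0 < x → x ≤ g^[n] d → ∀ k ≤ n, (Tmap γ)^[k] x ≤ d := by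
  induction n with
  | zero =>
    intro x hx hxd k hk
    obtain rfl : k = 0 := by omega
    simpa using hxd
  | succ n ih =>
    intro x hx hxd k hk
    rw [Function.iterate_succ_apply'] at hxd
    obtain ⟨i1, i2, -⟩ := g_lower h0 h1 hg hd hd1 one_pos n
    set y := g^[n] d
    obtain ⟨p1, p2⟩ := g_facts h0 h1 hg i1 (i2.trans hd1)
    obtain ⟨q1, q2⟩ := hg y ⟨i1.le, i2.trans hd1⟩
    cases k with
    | zero => simpa using hxd.trans (p2.trans i2)
    | succ k =>
      rw [Function.iterate_succ_apply]
      have hx2 := hxd.trans q1.2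
      rw [Tmap_eq_LL γ hx.le hx2]
      refine ih _ ?_ ?_ k (by omega)
      · have := (LL_le h0 h1 hx.le hx2).1
        linarith
      · have := (LL_strictMono h0 h1).monotoneOn ⟨hx.le, hx2⟩ q1 hxd
        rwa [q2] at this

noncomputable def ff (δ z : ℝ) : ℝ := max 0 (min 1 (2 / δ * z - 1))

lemma ff_mem (δ z : ℝ) : ff δ z ∈ Icc (0 : ℝ) 1 :=
  ⟨le_max_left _ _, max_le zero_le_one (min_le_left _ _)⟩

lemma ff_small {δ z : ℝ} (hδ : 0 < δ) (hz : z ≤ δ / 2) : ff δ z = 0 := by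
  unfold ff
  apply max_eq_left
  refine (min_le_right _ _).trans ?_
  have : 2 / δ * z ≤ 2 / δ * (δ / 2) := by gcongr
  have e : 2 / δ * (δ / 2) = 1 := by field_simp
  linarith

lemma ff_large {δ z : ℝ} (hδ : 0 < δ) (hz : δ ≤ z) : ff δ z = 1 := by
  unfold ff
  have : 2 / δ * δ ≤ 2 / δ * z := by gcongr
  have e : 2 / δ * δ = 2 := by field_simp
  rw [min_eq_left (by linarith)]
  simp

lemma ff_lip {δ : ℝ} (hδ : 0 < δ) : LipschitzWith (Real.toNNReal (2 / δ)) (ff δ) := by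
  have h : LipschitzWith (Real.toNNReal (2 / δ)) (fun z : ℝ => 2 / δ * z - 1) := by
    apply LipschitzWith.of_dist_le_mul
    intro x y
    rw [Real.dist_eq, Real.dist_eq, Real.coe_toNNReal _ (by positivity)]
    have : 2 / δ * x - 1 - (2 / δ * y - 1) = 2 / δ * (x - y) := by ring
    rw [this, abs_mul, abs_of_pos (by positivity)]
  exact (h.const_min 1).const_max 0

lemma ff_int {δ : ℝ} (hδ : 0 < δ) (ν : Measure ℝ) [IsProbabilityMeasure ν] :
    Integrable (ff δ) ν := by
  refine Integrable.of_bound (C := 1) (ff_lip hδ).continuous.aestronglyMeasurable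
    (Eventually.of_forall fun x => ?_)
  rw [Real.norm_eq_abs, abs_of_nonneg (ff_mem δ x).1]
  exact (ff_mem δ x).2

lemma ww_ge {θ δ lam z : ℝ} (hδ : 0 < δ) (hl : 0 ≤ lam) (hz : θ < z) :
    ENNReal.ofReal (Real.exp (lam * (1 - ff δ z))) ≤ ww θ δ lam z := by
  unfold ww
  split_ifs with h
  · apply ENNReal.ofReal_le_ofReal
    apply Real.exp_le_exp.2
    nlinarith [(ff_mem δ z).1]
  · have : δ < z := by
      by_contra h'
      exact h ⟨hz, not_lt.1 h'⟩
    rw [ff_large hδ this.le]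
    simp

lemma PP_ge {γ θ δ lam x : ℝ} (hδ : 0 < δ) (hl : 0 ≤ lam) (n : ℕ)
    (hz : ∀ k < n, θ < (Tmap γ)^[k] x) :
    ENNReal.ofReal (Real.exp (lam * (n - ∑ k ∈ Finset.range n, ff δ ((Tmap γ)^[k] x)))) ≤
      PP γ θ δ lam n x := by
  have e : lam * (n - ∑ k ∈ Finset.range n, ff δ ((Tmap γ)^[k] x)) =
      ∑ k ∈ Finset.range n, lam * (1 - ff δ ((Tmap γ)^[k] x)) := by
    rw [← Finset.mul_sum, Finset.sum_sub_distrib]; simp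
  rw [e, Real.exp_sum, ENNReal.ofReal_prod_of_nonneg fun _ _ => (Real.exp_pos _).le]
  unfold PP
  exact Finset.prod_le_prod' fun k hk => ww_ge hδ hl (hz k (Finset.mem_range.1 hk))

lemma n_le_exp {γ : ℝ} (h0 : 0 < γ) {n : ℕ} (hn : 1 ≤ n) :
    (n : ℝ) ≤ (2 / γ) ^ (1 / γ) * Real.exp ((n : ℝ) ^ γ / 2) := by
  have hn' : (0 : ℝ) < n := by exact_mod_cast hn
  set s := (n : ℝ) ^ γ with hs
  have hsp : 0 < s := Real.rpow_pos_of_pos hn' _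
  have e1 : (n : ℝ) = s ^ (1 / γ) := by
    rw [hs, ← Real.rpow_mul hn'.le, mul_one_div_cancel h0.ne', Real.rpow_one]
  have e2 : s = 2 / γ * (s * γ / 2) := by field_simp
  have e3 : Real.exp (s / 2) = (Real.exp (s * γ / 2)) ^ (1 / γ) := by
    rw [← Real.exp_mul]; congr 1; field_simp
  have e4 : s * γ / 2 ≤ Real.exp (s * γ / 2) := by linarith [Real.add_one_le_exp (s * γ / 2)]
  rw [e1, e3, ← Real.mul_rpow (by positivity) (by positivity)]
  apply Real.rpow_le_rpow hsp.le _ (by positivity)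
  calc s = 2 / γ * (s * γ / 2) := e2
    _ ≤ _ := by gcongr

lemma exists_delta {A K c : ℝ} (hc : 0 < c) : ∃ δ : ℝ, 0 < δ ∧ δ ≤ 1 / 2 ∧
    4 * A * K * δ ^ (1 / 8 : ℝ) ≤ c / 24 ∧ A * δ ^ (3 / 4 : ℝ) < 1 / 3 := by
  have t1 : Tendsto (fun δ : ℝ => 4 * A * K * δ ^ (1 / 8 : ℝ)) (𝓝[>] 0) (𝓝 0) := by
    have : Continuous (fun δ : ℝ => 4 * A * K * δ ^ (1 / 8 : ℝ)) :=
      continuous_const.mul (Real.continuous_rpow_const (by norm_num))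
    exact (this.tendsto' 0 0 (by simp)).mono_left nhdsWithin_le_nhds
  have t2 : Tendsto (fun δ : ℝ => A * δ ^ (3 / 4 : ℝ)) (𝓝[>] 0) (𝓝 0) := by
    have : Continuous (fun δ : ℝ => A * δ ^ (3 / 4 : ℝ)) :=
      continuous_const.mul (Real.continuous_rpow_const (by norm_num))
    exact (this.tendsto' 0 0 (by simp)).mono_left nhdsWithin_le_nhds
  have a1 := t1.eventually (gt_mem_nhds (show (0 : ℝ) < c / 24 by positivity))
  have a2 := t2.eventually (gt_mem_nhds (show (0 : ℝ) < 1 / 3 by norm_num))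
  have a3 := Ioo_mem_nhdsGT (show (0 : ℝ) < 1 / 2 by norm_num)
  obtain ⟨δ, h1, h2, h3⟩ := (a1.and (a2.and a3)).exists
  exact ⟨δ, h3.1, h3.2.le, h1.le, h2⟩

lemma event_upper {γ : ℝ} (h0 : 0 < γ) (h1 : γ ≤ 1) {A c K δ : ℝ} (ν : Measure ℝ)
    [IsProbabilityMeasure ν] (hac : ν ≪ volume) (hA : 0 < A) (hc : 0 < c)
    (hV : ∀ y ∈ Icc (0 : ℝ) 1, ν.real (Ioc 0 y) ≤ A * y ^ (3 / 4 : ℝ))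
    (hlow : ∀ a b, 0 ≤ a → a ≤ b → b ≤ 1 → c * (b - a) ≤ ν.real (Ioc a b))
    (hup : ∀ a b, 0 < a → a ≤ b → b ≤ 1 →
      ν.real (Ioc a b) ≤ A * a ^ (3 / 4 : ℝ) / a * (b - a))
    (hnull : ν (Ioc (0 : ℝ) 1)ᶜ = 0)
    (hinv : ∀ A : Set ℝ, MeasurableSet A → ν (Tmap γ ⁻¹' A) = ν A)
    (hK : ∀ x, 0 < x → x ≤ 1 / 2 → x ^ (1 / 8 : ℝ) ≤ K * vv γ x)
    (hδ0 : 0 < δ) (hδ : δ ≤ 1 / 2) (hδ1 : 4 * A * K * δ ^ (1 / 8 : ℝ) ≤ c / 24)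
    {n : ℕ} (hn : 1 ≤ n) :
    ν {x | ∑ k ∈ Finset.range n, ff δ ((Tmap γ)^[k] x) ≤ (n : ℝ) / 2} ≤
      ENNReal.ofReal ((A * (2 / γ) ^ (1 / γ) + (1 + c)) *
        Real.exp (-((Real.log 2) ^ (1 / γ - 1) / 48) * (n : ℝ) ^ γ)) := by
  have hn' : (0 : ℝ) < n := by exact_mod_cast hn
  have hn1 : (1 : ℝ) ≤ n := by exact_mod_cast hn
  have hsB := sB_eq h0 hn
  have hs1 : 1 ≤ (n : ℝ) ^ γ := Real.one_le_rpow hn1 h0.le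
  have hB1 : 1 ≤ ((n : ℝ) ^ γ) ^ (1 / γ - 1) := Real.one_le_rpow hs1 (beta_nonneg h0 h1)
  have hnexp := n_le_exp h0 hn
  have hcb := cb_pos γ
  have hcb1 := cb_le h0 h1
  have hvl := fun x hx hx2 hs => vv_lower h0 h1 (x := x) (s := (n : ℝ) ^ γ) hx hx2 hs
  set s := (n : ℝ) ^ γ
  set B := s ^ (1 / γ - 1)
  set cb := (Real.log 2) ^ (1 / γ - 1)
  set C := (2 / γ) ^ (1 / γ)
  set lam := cb / B / 12 with hlam
  set θ := Real.exp (-s) with hθ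
  have hl : 0 ≤ lam := by positivity
  have hl1 : lam ≤ 1 := by
    have : cb / B ≤ 1 := (div_le_one (by linarith)).2 (by linarith)
    rw [hlam]; linarith
  have hln : lam * n = cb * s / 12 := by
    rw [← hsB, hlam]; field_simp
  have hcond : ∀ x, 0 < x → x ∈ Ioc θ δ →
      lam ≤ vv γ x / 12 ∧ 4 * A * x ^ (1 / 4 : ℝ) ≤ c / 4 * vv γ x / 6 := by
    intro x hx hxx
    have hx2 := hxx.2.trans hδ
    refine ⟨?_, ?_⟩
    · have := hvl x hx hx2 hxx.1
      rw [hlam]; linarith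
    · have e : x ^ (1 / 4 : ℝ) = x ^ (1 / 8 : ℝ) * x ^ (1 / 8 : ℝ) := by
        rw [← Real.rpow_add hx]; norm_num
      have hv := vv_pos γ hx hx2
      have k1 : x ^ (1 / 8 : ℝ) ≤ δ ^ (1 / 8 : ℝ) := Real.rpow_le_rpow hx.le hxx.2 (by norm_num)
      have k2 := hK x hx hx2
      calc 4 * A * x ^ (1 / 4 : ℝ) = 4 * A * (x ^ (1 / 8 : ℝ) * x ^ (1 / 8 : ℝ)) := by rw [e]
        _ ≤ 4 * A * (δ ^ (1 / 8 : ℝ) * (K * vv γ x)) := by gcongr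
        _ = 4 * A * K * δ ^ (1 / 8 : ℝ) * vv γ x := by ring
        _ ≤ c / 24 * vv γ x := by gcongr
        _ = _ := by ring
  have hPP := PP_bound h0 h1 ν hac hA hc hlow hup hnull hinv hδ hl hl1 hcond n
  have hsub : {x | ∑ k ∈ Finset.range n, ff δ ((Tmap γ)^[k] x) ≤ (n : ℝ) / 2} ⊆
      ((Ioc (0 : ℝ) 1)ᶜ ∪ ⋃ k ∈ Finset.range n, (Tmap γ)^[k] ⁻¹' (Ioc 0 θ)) ∪
        {x | ENNReal.ofReal (Real.exp (lam * n / 2)) ≤ PP γ θ δ lam n x} := by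
    intro x hx
    simp only [Set.mem_setOf_eq] at hx
    by_cases hx1 : x ∈ Ioc (0 : ℝ) 1
    · by_cases hx2 : ∀ k < n, θ < (Tmap γ)^[k] x
      · right
        refine le_trans ?_ (PP_ge hδ0 hl n hx2)
        apply ENNReal.ofReal_le_ofReal
        apply Real.exp_le_exp.2
        nlinarith
      · left; right
        push Not at hx2
        obtain ⟨k, hk, hk2⟩ := hx2
        simp only [Set.mem_iUnion]
        exact ⟨k, Finset.mem_range.2 hk, (Tmap_iter h0 h1 hx1 k).1, hk2⟩
    · left; left; exact hx1
  have hθ1 : θ ≤ 1 := by rw [hθ]; exact Real.exp_le_one_iff.2 (by linarith)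
  have hθ0 : 0 < θ := Real.exp_pos _
  have hbad : ν (⋃ k ∈ Finset.range n, (Tmap γ)^[k] ⁻¹' (Ioc 0 θ)) ≤
      ENNReal.ofReal (A * C * Real.exp (-(cb / 48) * s)) := by
    calc _ ≤ ∑ k ∈ Finset.range n, ν ((Tmap γ)^[k] ⁻¹' (Ioc 0 θ)) :=
          measure_biUnion_finset_le _ _
      _ = n * ν (Ioc 0 θ) := by
          rw [Finset.sum_congr rfl fun k _ => hinv_iter ν hinv k measurableSet_Ioc]
          simp
      _ ≤ ENNReal.ofReal n * ENNReal.ofReal (A * θ ^ (3 / 4 : ℝ)) := by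
          rw [ENNReal.ofReal_natCast]
          gcongr
          rw [← ofReal_measureReal]
          exact ENNReal.ofReal_le_ofReal (hV θ ⟨hθ0.le, hθ1⟩)
      _ ≤ _ := by
          rw [← ENNReal.ofReal_mul hn'.le]
          apply ENNReal.ofReal_le_ofReal
          have e : θ ^ (3 / 4 : ℝ) = Real.exp (-s * (3 / 4)) := by rw [hθ, ← Real.exp_mul]
          rw [e]
          calc (n : ℝ) * (A * Real.exp (-s * (3 / 4)))
              ≤ (C * Real.exp (s / 2)) * (A * Real.exp (-s * (3 / 4))) := by gcongr
            _ = A * C * Real.exp (-s / 4) := by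
                have : Real.exp (-s / 4) = Real.exp (s / 2) * Real.exp (-s * (3 / 4)) := by
                  rw [← Real.exp_add]; congr 1; ring
                rw [this]; ring
            _ ≤ _ := by
                have hC : 0 ≤ C := by positivity
                gcongr
                nlinarith
  have hmark : ν {x | ENNReal.ofReal (Real.exp (lam * n / 2)) ≤ PP γ θ δ lam n x} ≤
      ENNReal.ofReal ((1 + c) * Real.exp (-(cb / 48) * s)) := by
    have hm := (mul_meas_ge_le_lintegral (μ := ν) (PP_meas γ θ δ lam n)
      (ENNReal.ofReal (Real.exp (lam * n / 2)))).trans hPP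
    have e : ENNReal.ofReal ((1 + c) * Real.exp (lam * n / 4)) =
        ENNReal.ofReal (Real.exp (lam * n / 2)) *
          ENNReal.ofReal ((1 + c) * Real.exp (-(cb / 48) * s)) := by
      rw [← ENNReal.ofReal_mul (Real.exp_pos _).le]
      congr 1
      have : Real.exp (lam * n / 4) = Real.exp (lam * n / 2) * Real.exp (-(cb / 48) * s) := by
        rw [← Real.exp_add]; congr 1; rw [hln]; ring
      rw [this]; ring
    rw [e] at hm
    exact (ENNReal.mul_le_mul_iff_right (by simpa using Real.exp_pos _) ENNReal.ofReal_ne_top).1 hm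
  calc _ ≤ ν _ := measure_mono hsub
    _ ≤ (ν (Ioc (0 : ℝ) 1)ᶜ + ν (⋃ k ∈ Finset.range n, (Tmap γ)^[k] ⁻¹' (Ioc 0 θ))) +
        ν {x | ENNReal.ofReal (Real.exp (lam * n / 2)) ≤ PP γ θ δ lam n x} :=
        (measure_union_le _ _).trans (add_le_add_left (measure_union_le _ _) _)
    _ ≤ (0 + ENNReal.ofReal (A * C * Real.exp (-(cb / 48) * s))) +
        ENNReal.ofReal ((1 + c) * Real.exp (-(cb / 48) * s)) := by
        rw [hnull]; gcongr
    _ = _ := by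
        rw [zero_add, ← ENNReal.ofReal_add (by positivity) (by positivity)]
        congr 1; ring

lemma ff_integral {A δ : ℝ} (ν : Measure ℝ) [IsProbabilityMeasure ν]
    (hV : ∀ y ∈ Icc (0 : ℝ) 1, ν.real (Ioc 0 y) ≤ A * y ^ (3 / 4 : ℝ))
    (hnull : ν (Ioc (0 : ℝ) 1)ᶜ = 0) (hδ0 : 0 < δ) (hδ : δ ≤ 1 / 2)
    (hδ2 : A * δ ^ (3 / 4 : ℝ) < 1 / 3) :
    2 / 3 < ∫ x, ff δ x ∂ν ∧ ∫ x, ff δ x ∂ν ≤ 1 := by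
  constructor
  · have a1 : ν.real (Ioc 0 1) = 1 := by
      have h := measureReal_add_measureReal_compl (μ := ν) (measurableSet_Ioc (a := (0 : ℝ)) (b := 1))
      rw [measureReal_def ν (Ioc (0 : ℝ) 1)ᶜ, hnull] at h
      simpa using h
    have a2 : ν.real (Ioc 0 1) ≤ ν.real (Ioc 0 δ) + ν.real (Ioc δ 1) := by
      rw [← Ioc_union_Ioc_eq_Ioc hδ0.le (by linarith : δ ≤ 1)]
      exact measureReal_union_le _ _
    have a3 := hV δ ⟨hδ0.le, by linarith⟩
    have a4 : ν.real (Ioc δ 1) ≤ ∫ x, ff δ x ∂ν := by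
      rw [← integral_indicator_one measurableSet_Ioc]
      apply integral_mono
      · exact (integrable_indicator_iff measurableSet_Ioc).2 (integrable_const (1 : ℝ)).integrableOn
      · exact ff_int hδ0 ν
      · intro x
        by_cases hx : x ∈ Ioc δ 1
        · simp [hx, ff_large hδ0 hx.1.le]
        · simp [hx, (ff_mem δ x).1]
    linarith
  · calc ∫ x, ff δ x ∂ν ≤ ∫ _, (1 : ℝ) ∂ν :=
        integral_mono (ff_int hδ0 ν) (integrable_const _) fun x => (ff_mem δ x).2
      _ = 1 := by simp

theorem stmt6 (γ : ℝ) (hγ0 : 0 < γ) (hγ1 : γ ≤ 1)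
    (ν : Measure ℝ) [IsProbabilityMeasure ν]
    (hsupp : ν (Set.Icc (0 : ℝ) 1)ᶜ = 0) (hac : ν ≪ volume)
    (hinv : ∀ A : Set ℝ, MeasurableSet A → ν (Tmap γ ⁻¹' A) = ν A) :
    ∃ f : ℝ → ℝ,
      (∃ Lc : NNReal, LipschitzOnWith Lc f (Set.Icc (0 : ℝ) 1)) ∧
      Set.MapsTo f (Set.Icc (0 : ℝ) 1) (Set.Icc (0 : ℝ) 1) ∧
      0 < ∫ x, f x ∂ν ∧
      ∃ c1 c2 κ1 κ2 : ℝ, 0 < c1 ∧ 0 < c2 ∧ 0 < κ1 ∧ 0 < κ2 ∧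
        ∀ n : ℕ, 2 / (∫ x, f x ∂ν) < (n : ℝ) →
          ENNReal.ofReal (c1 * Real.exp (-κ1 * (n : ℝ) ^ γ)) ≤
            ν {x ∈ Set.Icc (0 : ℝ) 1 |
              (n : ℝ) * (∫ z, f z ∂ν) / 2 <
                |(∑ k ∈ Finset.range n, f ((Tmap γ)^[k] x)) - n * ∫ z, f z ∂ν|} ∧
          ν {x ∈ Set.Icc (0 : ℝ) 1 |
              (n : ℝ) * (∫ z, f z ∂ν) / 2 <
                |(∑ k ∈ Finset.range n, f ((Tmap γ)^[k] x)) - n * ∫ z, f z ∂ν|} ≤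
            ENNReal.ofReal (c2 * Real.exp (-κ2 * (n : ℝ) ^ γ)) := by
  obtain ⟨g, A, Λ, hA1, hG, hg⟩ := exists_goodG hγ0 hγ1
  have hA : 0 < A := by linarith
  obtain ⟨c, hc, hV, hlow, hup⟩ := nu_facts hγ0 hγ1 hG hg ν hsupp hac hinv
  have hnull := nu_compl ν hsupp hac
  obtain ⟨K, hK1, hK⟩ := vv_key hγ0 hγ1
  obtain ⟨δ, hδ0, hδ, hδ1, hδ2⟩ := exists_delta (A := A) (K := K) hc
  obtain ⟨hI1, hI2⟩ := ff_integral ν hV hnull hδ0 hδ hδ2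
  refine ⟨ff δ, ⟨_, (ff_lip hδ0).lipschitzOnWith⟩, fun x _ => ff_mem δ x, by linarith,
    c * (δ / 2), A * (2 / γ) ^ (1 / γ) + (1 + c), 2, (Real.log 2) ^ (1 / γ - 1) / 48,
    by positivity, by positivity, by norm_num, by have := cb_pos γ; positivity, ?_⟩
  intro n hn
  set I := ∫ x, ff δ x ∂ν
  have hnpos : (0 : ℝ) < n := lt_trans (by positivity) hn
  have hn1 : 1 ≤ n := by exact_mod_cast hnpos
  have hsp : 0 < (n : ℝ) ^ γ := Real.rpow_pos_of_pos hnpos _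
  constructor
  · obtain ⟨p1, p2, p3⟩ := g_lower hγ0 hγ1 hg (d := δ / 2) (s := (n : ℝ) ^ γ) (by linarith)
      (by linarith) hsp n
    have hb : (n : ℝ) * ((Real.log 2) ^ (1 / γ - 1) / ((n : ℝ) ^ γ) ^ (1 / γ - 1)) ≤
        (n : ℝ) ^ γ := by
      have hBp : 0 < ((n : ℝ) ^ γ) ^ (1 / γ - 1) := Real.rpow_pos_of_pos hsp _
      rw [← mul_div_assoc, div_le_iff₀ hBp, sB_eq hγ0 hn1]
      nlinarith [cb_le hγ0 hγ1]
    have hlogd : δ / 2 * Real.exp (-2 * (n : ℝ) ^ γ) ≤ g^[n] (δ / 2) := by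
      rw [← Real.exp_log (show 0 < δ / 2 by linarith), ← Real.exp_add]
      rw [Real.exp_log (show 0 < δ / 2 by linarith)]
      rw [← Real.le_log_iff_exp_le p1]
      linarith
    have hsub : Ioc 0 (g^[n] (δ / 2)) ⊆ {x ∈ Set.Icc (0 : ℝ) 1 | (n : ℝ) * I / 2 <
        |(∑ k ∈ Finset.range n, ff δ ((Tmap γ)^[k] x)) - n * I|} := by
      intro x hx
      refine ⟨⟨hx.1.le, by linarith [hx.2]⟩, ?_⟩
      have ho := orbit_small hγ0 hγ1 hg (d := δ / 2) (by linarith) (by linarith) n x hx.1 hx.2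
      rw [Finset.sum_eq_zero fun k hk => ff_small hδ0 (ho k (Finset.mem_range.1 hk).le)]
      have : 0 < (n : ℝ) * I := mul_pos hnpos (by linarith)
      rw [zero_sub, abs_neg, abs_of_pos this]
      linarith
    refine le_trans ?_ (measure_mono hsub)
    rw [← ofReal_measureReal]
    apply ENNReal.ofReal_le_ofReal
    refine le_trans ?_ (hlow 0 _ le_rfl p1.le (by linarith))
    rw [sub_zero, mul_assoc]
    gcongr
  · refine le_trans (measure_mono ?_)
      (event_upper hγ0 hγ1 ν hac hA hc hV hlow hup hnull hinv hK hδ0 hδ hδ1 hn1)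
    rintro x ⟨-, hx⟩
    simp only [Set.mem_setOf_eq]
    have hS : ∑ k ∈ Finset.range n, ff δ ((Tmap γ)^[k] x) ≤ n := by
      calc _ ≤ ∑ k ∈ Finset.range n, (1 : ℝ) := Finset.sum_le_sum fun k _ => (ff_mem δ _).2
        _ = n := by simp
    rcases lt_abs.1 hx with h | h
    · nlinarith
    · nlinarith
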